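/- For every q with 0 < q < 1, exp(√5 · ∫_0^q f(-t)^5 / (f(-t^{1/5}) · t^{4/5}) dt) = (125 + 11w + 5√5·√(125 + 22w + w²)) / ((11 + 5√5)·w), where w = u(q^{1/5}) = f(-q^{1/5})^6 / (q^{1/5} · f(-q)^6). -/

import Mathlib

open MeasureTheory Real

/-- Euler's product `f(-q) = ∏_{n=1}^∞ (1 - qⁿ)`. -/
noncomputable def eulerF (q : ℝ) : ℝ := ∏' n : ℕ, (1 - q ^ (n + 1))

/-- `u(q) = f(-q)⁶ / (q · f(-q⁵)⁶)`. -/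
noncomputable def uF (q : ℝ) : ℝ := eulerF q ^ 6 / (q * eulerF (q ^ 5) ^ 6)

open Filter Topology

theorem summable_norm_pow_mul_cexp_quadratic (k : ℕ) {a : ℂ} (ha : a.re < 0) (b c : ℂ) :
    Summable fun n : ℤ ↦ ‖(n : ℂ) ^ k * Complex.exp (a * n ^ 2 + b * n + c)‖ := by
  have hT : 0 < -a.re / π := div_pos (by linarith) pi_pos
  refine Summable.of_nonneg_of_le (fun _ ↦ norm_nonneg _) (fun n ↦ ?_)
    ((summable_pow_mul_jacobiTheta₂_term_bound (|b.re| / (2 * π)) hT k).mul_left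
      (Real.exp c.re))
  have h1 : (a * n ^ 2 + b * n + c).re = a.re * n ^ 2 + b.re * n + c.re := by
    have : ((n : ℂ) ^ 2) = (((n : ℝ) ^ 2 : ℝ) : ℂ) := by push_cast; ring
    rw [this, show (n : ℂ) = ((n : ℝ) : ℂ) by simp]
    simp only [Complex.add_re, Complex.re_mul_ofReal]
  rw [norm_mul, Complex.norm_exp, h1, norm_pow, Complex.norm_intCast]
  rw [show Real.exp c.re * (((|n| : ℤ) : ℝ) ^ k *
      Real.exp (-π * (-a.re / π * n ^ 2 - 2 * (|b.re| / (2 * π)) * ((|n| : ℤ) : ℝ)))) =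
      |(n : ℝ)| ^ k * (Real.exp c.re *
      Real.exp (-π * (-a.re / π * n ^ 2 - 2 * (|b.re| / (2 * π)) * ((|n| : ℤ) : ℝ)))) by
        push_cast; ring]
  rw [← Real.exp_add]
  refine mul_le_mul_of_nonneg_left (Real.exp_le_exp.2 ?_) (by positivity)
  have h2 : -π * (-a.re / π * n ^ 2 - 2 * (|b.re| / (2 * π)) * ((|n| : ℤ) : ℝ)) =
      a.re * n ^ 2 + |b.re| * |(n : ℝ)| := by
    push_cast
    field_simp
    ring
  rw [h2]
  have h3 : b.re * n ≤ |b.re| * |(n : ℝ)| := by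
    rw [← abs_mul]; exact le_abs_self _
  linarith

theorem norm_neg_one_zpow (n : ℤ) : ‖(-1 : ℂ) ^ n‖ = 1 := by
  simp

theorem summable_norm_theta (k : ℕ) {a : ℂ} (ha : a.re < 0) (b c : ℂ) :
    Summable fun n : ℤ ↦
      ‖(-1 : ℂ) ^ n * ((n : ℂ) ^ k * Complex.exp (a * n ^ 2 + b * n + c))‖ := by
  refine (summable_norm_pow_mul_cexp_quadratic k ha b c).congr fun n ↦ ?_
  rw [norm_mul ((-1 : ℂ) ^ n), norm_neg_one_zpow, one_mul]

/-- The infinite `q`-Pochhammer symbol `(a; q)_∞ = ∏_{n ≥ 0} (1 - a qⁿ)`. -/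
noncomputable def qPoch (a q : ℂ) : ℂ := ∏' n : ℕ, (1 - a * q ^ n)

theorem summable_norm_qPoch (a : ℂ) {q : ℂ} (hq : ‖q‖ < 1) :
    Summable fun n : ℕ ↦ ‖-(a * q ^ n)‖ := by
  simp only [norm_neg, norm_mul, norm_pow]
  exact (summable_geometric_of_lt_one (norm_nonneg _) hq).mul_left _

theorem multipliable_qPoch (a : ℂ) {q : ℂ} (hq : ‖q‖ < 1) :
    Multipliable fun n : ℕ ↦ (1 - a * q ^ n) := by
  simpa only [sub_eq_add_neg] using multipliable_one_add_of_summable (summable_norm_qPoch a hq)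

theorem tendsto_qPoch (a : ℂ) {q : ℂ} (hq : ‖q‖ < 1) :
    Tendsto (fun n ↦ ∏ k ∈ Finset.range n, (1 - a * q ^ k)) atTop (𝓝 (qPoch a q)) :=
  (multipliable_qPoch a hq).hasProd.tendsto_prod_nat

theorem qPoch_ne_zero {a q : ℂ} (hq : ‖q‖ < 1) (h : ∀ n : ℕ, a * q ^ n ≠ 1) :
    qPoch a q ≠ 0 := by
  have := tprod_one_add_ne_zero_of_summable (f := fun n : ℕ ↦ -(a * q ^ n))
    (fun n ↦ by rw [← sub_eq_add_neg]; exact sub_ne_zero.2 (h n).symm) (summable_norm_qPoch a hq)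
  simpa only [sub_eq_add_neg, qPoch] using this

theorem prod_range_mul_eq_prod_prod {M : Type*} [CommMonoid M] (g : ℕ → M) (N n : ℕ) :
    ∏ k ∈ Finset.range (N * n), g k =
      ∏ c ∈ Finset.range N, ∏ k ∈ Finset.range n, g (N * k + c) := by
  induction n with
  | zero => simp
  | succ n ih =>
    rw [Nat.mul_succ, Finset.prod_range_add, ih, ← Finset.prod_mul_distrib]
    exact Finset.prod_congr rfl fun c _ ↦ (Finset.prod_range_succ _ _).symm

theorem qPoch_eq_prod (a : ℂ) {q : ℂ} (hq : ‖q‖ < 1) {N : ℕ} (hN : N ≠ 0) :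
    qPoch a q = ∏ c ∈ Finset.range N, qPoch (a * q ^ c) (q ^ N) := by
  have hqN : ‖q ^ N‖ < 1 := by
    rw [norm_pow]; exact pow_lt_one₀ (norm_nonneg _) hq hN
  have h1 := (tendsto_qPoch a hq).comp
    (tendsto_id.const_mul_atTop' (Nat.pos_of_ne_zero hN) : Tendsto (fun n ↦ N * n) atTop atTop)
  have h2 := tendsto_finsetProd (Finset.range N)
    fun c _ ↦ tendsto_qPoch (a * q ^ c) hqN
  refine tendsto_nhds_unique h1 (h2.congr fun n ↦ ?_)
  simp only [Function.comp_apply, prod_range_mul_eq_prod_prod]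
  refine Finset.prod_congr rfl fun c _ ↦ Finset.prod_congr rfl fun k _ ↦ ?_
  rw [pow_add, pow_mul]; ring

/-- The finite product `(q; q)_n`. -/
noncomputable def qFac (q : ℂ) (n : ℕ) : ℂ := ∏ k ∈ Finset.range n, (1 - q * q ^ k)

/-- The reciprocal of `(q; q)_n`, extended by zero to negative `n`. -/
noncomputable def qFacInv (q : ℂ) : ℤ → ℂ
  | Int.ofNat n => (qFac q n)⁻¹
  | Int.negSucc _ => 0

theorem mul_pow_ne_one {q : ℂ} (hq : ‖q‖ < 1) (n : ℕ) : q * q ^ n ≠ 1 := by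
  intro h
  have := congrArg norm h
  rw [← pow_succ', norm_pow, norm_one] at this
  exact (pow_lt_one₀ (norm_nonneg _) hq n.succ_ne_zero).ne this

theorem qFac_ne_zero {q : ℂ} (hq : ‖q‖ < 1) (n : ℕ) : qFac q n ≠ 0 :=
  Finset.prod_ne_zero_iff.2 fun k _ ↦ sub_ne_zero.2 (mul_pow_ne_one hq k).symm

theorem qFacInv_sub_one {q : ℂ} (hq : ‖q‖ < 1) (k : ℤ) :
    qFacInv q (k - 1) = (1 - q ^ k) * qFacInv q k := by
  rcases k with n | n
  · cases n with
    | zero =>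
      rw [show (Int.ofNat 0 - 1 : ℤ) = Int.negSucc 0 from rfl]
      simp [qFacInv]
    | succ n =>
      rw [show (Int.ofNat (n + 1) - 1 : ℤ) = Int.ofNat n by simp]
      have h1 := qFac_ne_zero hq n
      have h2 := qFac_ne_zero hq (n + 1)
      have h3 : qFac q (n + 1) = qFac q n * (1 - q * q ^ n) := Finset.prod_range_succ _ _
      simp only [qFacInv]
      rw [h3] at h2 ⊢
      have h4 := right_ne_zero_of_mul h2
      rw [show q ^ (Int.ofNat (n + 1)) = q * q ^ n by
        rw [Int.ofNat_eq_natCast, zpow_natCast, pow_succ']]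
      field_simp
  · rw [show Int.negSucc n - 1 = Int.negSucc (n + 1) by omega]
    simp [qFacInv]

/-- The coefficient `(q; q)_{2n} / ((q; q)_{n+j} (q; q)_{n-j})`. -/
noncomputable def qCentral (q : ℂ) (n : ℕ) (j : ℤ) : ℂ :=
  qFac q (2 * n) * qFacInv q (n + j) * qFacInv q (n - j)

theorem qCentral_zero (q : ℂ) (j : ℤ) : qCentral q 0 j = if j = 0 then 1 else 0 := by
  rcases j with (_ | n) | n
  · simp [qCentral, qFacInv, qFac]
  · have : (0 : ℤ) - Int.ofNat (n + 1) = Int.negSucc n := by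
      rw [Int.ofNat_eq_natCast, Int.negSucc_eq]; omega
    simp only [qCentral, Nat.cast_zero, this, qFacInv, mul_zero]
    rw [if_neg (by rw [Int.ofNat_eq_natCast]; omega)]
  · simp [qCentral, qFacInv]

theorem qCentral_succ {q : ℂ} (hq : ‖q‖ < 1) (hq0 : q ≠ 0) (n : ℕ) (j : ℤ) :
    qCentral q (n + 1) j = (1 + q ^ (2 * n + 1)) * qCentral q n j +
      q ^ ((n : ℤ) + 1 - j) * qCentral q n (j - 1) +
      q ^ ((n : ℤ) + 1 + j) * qCentral q n (j + 1) := by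
  have e1 : qFacInv q (n + j) = (1 - q ^ ((n : ℤ) + 1 + j)) * qFacInv q (n + 1 + j) := by
    rw [← qFacInv_sub_one hq]; congr 1; ring
  have e2 : qFacInv q (n - j) = (1 - q ^ ((n : ℤ) + 1 - j)) * qFacInv q (n + 1 - j) := by
    rw [← qFacInv_sub_one hq]; congr 1; ring
  have e3 : qFacInv q (n + (j - 1)) = (1 - q ^ ((n : ℤ) + j)) * qFacInv q (n + j) := by
    rw [← qFacInv_sub_one hq]; congr 1; ring
  have e4 : qFacInv q (n - (j + 1)) = (1 - q ^ ((n : ℤ) - j)) * qFacInv q (n - j) := by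
    rw [← qFacInv_sub_one hq]; congr 1; ring
  have e5 : qFac q (2 * (n + 1)) =
      qFac q (2 * n) * (1 - q ^ (2 * n + 1)) * (1 - q ^ (2 * n + 2)) := by
    rw [show 2 * (n + 1) = 2 * n + 1 + 1 by ring, qFac, Finset.prod_range_succ,
      Finset.prod_range_succ, qFac]
    ring
  have u1 : q ^ ((n : ℤ) + 1 + j) = q ^ n * q * q ^ j := by
    rw [zpow_add₀ hq0, zpow_add₀ hq0]; simp
  have u2 : q ^ ((n : ℤ) + 1 - j) = q ^ n * q * (q ^ j)⁻¹ := by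
    rw [zpow_sub₀ hq0, zpow_add₀ hq0]; simp [div_eq_mul_inv]
  have u3 : q ^ ((n : ℤ) + j) = q ^ n * q ^ j := by
    rw [zpow_add₀ hq0]; simp
  have u4 : q ^ ((n : ℤ) - j) = q ^ n * (q ^ j)⁻¹ := by
    rw [zpow_sub₀ hq0]; simp [div_eq_mul_inv]
  have e6 : (n : ℤ) - (j - 1) = n + 1 - j := by ring
  have e7 : (n : ℤ) + (j + 1) = n + 1 + j := by ring
  simp only [qCentral, Nat.cast_add, Nat.cast_one, e5, e6, e7, e3, e4, e1, e2, u1, u2, u3, u4]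
  have hj : q ^ j ≠ 0 := zpow_ne_zero _ hq0
  field_simp
  ring

/-- The coefficient of `z ^ j` in the finite form of the Jacobi triple product. -/
noncomputable def tripleCoeff (τ : ℂ) (n : ℕ) (j : ℤ) : ℂ :=
  (-1) ^ j * Complex.exp (τ * (j * (j - 1) / 2)) * qCentral (Complex.exp τ) n j

theorem tripleCoeff_succ {τ : ℂ} (hτ : τ.re < 0) (n : ℕ) (j : ℤ) :
    tripleCoeff τ (n + 1) j = (1 + Complex.exp τ ^ (2 * n + 1)) * tripleCoeff τ n j -
      Complex.exp τ ^ n * tripleCoeff τ n (j - 1) -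
      Complex.exp τ ^ (n + 1) * tripleCoeff τ n (j + 1) := by
  have hq : ‖Complex.exp τ‖ < 1 := by rwa [Complex.norm_exp, Real.exp_lt_one_iff]
  simp only [tripleCoeff, qCentral_succ hq (Complex.exp_ne_zero _)]
  have h1 : (-1 : ℂ) ^ (j - 1) = -(-1) ^ j := by
    rw [zpow_sub_one₀ (by norm_num)]; simp
  have h2 : (-1 : ℂ) ^ (j + 1) = -(-1) ^ j := by
    rw [zpow_add_one₀ (by norm_num)]; simp
  have h3 : Complex.exp (τ * (j * (j - 1) / 2)) * Complex.exp τ ^ ((n : ℤ) + 1 - j) =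
      Complex.exp τ ^ n * Complex.exp (τ * (((j - 1 : ℤ) : ℂ) * ((j - 1 : ℤ) - 1) / 2)) := by
    rw [← Complex.exp_int_mul, ← Complex.exp_nat_mul, ← Complex.exp_add, ← Complex.exp_add]
    congr 1; push_cast; ring
  have h4 : Complex.exp (τ * (j * (j - 1) / 2)) * Complex.exp τ ^ ((n : ℤ) + 1 + j) =
      Complex.exp τ ^ (n + 1) *
        Complex.exp (τ * (((j + 1 : ℤ) : ℂ) * ((j + 1 : ℤ) - 1) / 2)) := by
    rw [← Complex.exp_int_mul, ← Complex.exp_nat_mul, ← Complex.exp_add, ← Complex.exp_add]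
    congr 1; push_cast; ring
  rw [h1, h2]
  linear_combination (-1) ^ j * qCentral (Complex.exp τ) n (j - 1) * h3 +
    (-1) ^ j * qCentral (Complex.exp τ) n (j + 1) * h4

theorem HasSum.comp_add_int {f : ℤ → ℂ} {s : ℂ} (h : HasSum f s) (c : ℤ) :
    HasSum (fun j ↦ f (j + c)) s :=
  (Equiv.addRight c).hasSum_iff.2 h

theorem hasSum_tripleCoeff {τ : ℂ} (hτ : τ.re < 0) {z : ℂ} (hz : z ≠ 0) (n : ℕ) :
    HasSum (fun j : ℤ ↦ tripleCoeff τ n j * z ^ j)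
      ((∏ k ∈ Finset.range n, (1 - z * Complex.exp τ ^ k)) *
        ∏ k ∈ Finset.range n, (1 - Complex.exp τ / z * Complex.exp τ ^ k)) := by
  induction n with
  | zero =>
    have : (fun j : ℤ ↦ tripleCoeff τ 0 j * z ^ j) = fun j ↦ if j = 0 then 1 else 0 := by
      funext j
      by_cases hj : j = 0 <;> simp [tripleCoeff, qCentral_zero, hj]
    rw [this]
    simpa using hasSum_ite_eq (0 : ℤ) (1 : ℂ)
  | succ n ih =>
    have h1 : HasSum (fun j : ℤ ↦ tripleCoeff τ n (j - 1) * z ^ (j - 1)) _ :=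
      ih.comp_add_int (-1)
    have h2 : HasSum (fun j : ℤ ↦ tripleCoeff τ n (j + 1) * z ^ (j + 1)) _ :=
      ih.comp_add_int 1
    have h := ((ih.mul_left (1 + Complex.exp τ ^ (2 * n + 1))).sub
      (h1.mul_left (Complex.exp τ ^ n * z))).sub (h2.mul_left (Complex.exp τ ^ (n + 1) / z))
    convert! h using 1
    · funext j
      rw [tripleCoeff_succ hτ, zpow_sub_one₀ hz, zpow_add_one₀ hz]
      field_simp
    · rw [Finset.prod_range_succ, Finset.prod_range_succ]
      field_simp
      ring

theorem hasSum_mul_tripleCoeff {τ : ℂ} (hτ : τ.re < 0) (n : ℕ) :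
    HasSum (fun j : ℤ ↦ tripleCoeff τ (n + 1) j * j)
      (-(qFac (Complex.exp τ) n * qFac (Complex.exp τ) (n + 1))) := by
  have key (n : ℕ) {s t : ℂ} (hs : HasSum (fun j : ℤ ↦ tripleCoeff τ n j) s)
      (ht : HasSum (fun j : ℤ ↦ tripleCoeff τ n j * j) t) :
      HasSum (fun j : ℤ ↦ tripleCoeff τ (n + 1) j * j)
        ((1 - Complex.exp τ ^ n) * (1 - Complex.exp τ ^ (n + 1)) * t +
          (Complex.exp τ ^ (n + 1) - Complex.exp τ ^ n) * s) := by
    have h1 : HasSum (fun j : ℤ ↦ tripleCoeff τ n (j - 1) * ((j - 1 : ℤ) : ℂ)) _ :=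
      ht.comp_add_int (-1)
    have h2 : HasSum (fun j : ℤ ↦ tripleCoeff τ n (j + 1) * ((j + 1 : ℤ) : ℂ)) _ :=
      ht.comp_add_int 1
    have h3 : HasSum (fun j : ℤ ↦ tripleCoeff τ n (j - 1)) _ :=
      hs.comp_add_int (-1)
    have h4 : HasSum (fun j : ℤ ↦ tripleCoeff τ n (j + 1)) _ :=
      hs.comp_add_int 1
    convert! ((ht.mul_left (1 + Complex.exp τ ^ (2 * n + 1))).sub
      ((h1.add h3).mul_left (Complex.exp τ ^ n))).sub
      ((h2.sub h4).mul_left (Complex.exp τ ^ (n + 1))) using 1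
    · funext j
      rw [tripleCoeff_succ hτ]
      push_cast
      ring
    · ring
  induction n with
  | zero =>
    have hs : HasSum (fun j : ℤ ↦ tripleCoeff τ 0 j) 1 := by
      simpa using hasSum_tripleCoeff hτ one_ne_zero 0
    have ht : HasSum (fun j : ℤ ↦ tripleCoeff τ 0 j * j) 0 := by
      convert! (hasSum_zero : HasSum (fun _ : ℤ ↦ (0 : ℂ)) 0) using 2 with j
      by_cases hj : j = 0 <;> simp [tripleCoeff, qCentral_zero, hj]
    convert key 0 hs ht using 1
    simp [qFac]
  | succ n ih =>
    have hs : HasSum (fun j : ℤ ↦ tripleCoeff τ (n + 1) j) 0 := by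
      have := hasSum_tripleCoeff hτ one_ne_zero (n + 1)
      rw [Finset.prod_range_succ'] at this
      simpa using this
    convert key (n + 1) hs ih using 1
    have e (m : ℕ) : qFac (Complex.exp τ) (m + 1) =
      qFac (Complex.exp τ) m * (1 - Complex.exp τ * Complex.exp τ ^ m) := Finset.prod_range_succ _ _
    rw [e (n + 1), e n]
    ring

theorem norm_cexp_lt_one {τ : ℂ} (hτ : τ.re < 0) : ‖Complex.exp τ‖ < 1 := by
  rwa [Complex.norm_exp, Real.exp_lt_one_iff]

theorem qPoch_self_ne_zero {q : ℂ} (hq : ‖q‖ < 1) : qPoch q q ≠ 0 :=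
  qPoch_ne_zero hq (mul_pow_ne_one hq)

theorem tendsto_qFac {q : ℂ} (hq : ‖q‖ < 1) : Tendsto (qFac q) atTop (𝓝 (qPoch q q)) :=
  tendsto_qPoch q hq

theorem tendsto_qFacInv {q : ℂ} (hq : ‖q‖ < 1) (j : ℤ) :
    Tendsto (fun n : ℕ ↦ qFacInv q (n + j)) atTop (𝓝 (qPoch q q)⁻¹) := by
  have h : Tendsto (fun n : ℕ ↦ ((n : ℤ) + j).toNat) atTop atTop := by
    refine tendsto_atTop.2 fun b ↦ ?_
    filter_upwards [eventually_ge_atTop (b + j.natAbs)] with n hn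
    omega
  refine (((tendsto_qFac hq).inv₀ (qPoch_self_ne_zero hq)).comp h).congr' ?_
  filter_upwards [eventually_ge_atTop j.natAbs] with n hn
  have : (n : ℤ) + j = Int.ofNat ((n : ℤ) + j).toNat := by rw [Int.ofNat_eq_natCast]; omega
  rw [this]
  simp [qFacInv]

theorem tendsto_qCentral {q : ℂ} (hq : ‖q‖ < 1) (j : ℤ) :
    Tendsto (fun n : ℕ ↦ qCentral q n j) atTop (𝓝 (qPoch q q)⁻¹) := by
  have h1 := (tendsto_qFac hq).comp
    (tendsto_id.const_mul_atTop' two_pos : Tendsto (fun n ↦ 2 * n) atTop atTop)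
  have h := (h1.mul (tendsto_qFacInv hq j)).mul (tendsto_qFacInv hq (-j))
  rw [mul_inv_cancel₀ (qPoch_self_ne_zero hq), one_mul] at h
  exact h

theorem exists_norm_qCentral_le {q : ℂ} (hq : ‖q‖ < 1) :
    ∃ C, ∀ n j, ‖qCentral q n j‖ ≤ C := by
  obtain ⟨M, hM⟩ := (tendsto_qFac hq).norm.bddAbove_range
  obtain ⟨K, hK⟩ := ((tendsto_qFac hq).inv₀ (qPoch_self_ne_zero hq)).norm.bddAbove_range
  have hM' (n : ℕ) : ‖qFac q n‖ ≤ M := hM ⟨n, rfl⟩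
  have hK0 : 0 ≤ K := (norm_nonneg _).trans (hK ⟨0, rfl⟩)
  have hM0 : 0 ≤ M := (norm_nonneg _).trans (hM' 0)
  have hK' (k : ℤ) : ‖qFacInv q k‖ ≤ K := by
    rcases k with n | n
    · exact hK ⟨n, rfl⟩
    · simpa [qFacInv] using hK0
  refine ⟨M * K * K, fun n j ↦ ?_⟩
  rw [qCentral, norm_mul, norm_mul]
  have := hM' (2 * n)
  have := hK' (n + j)
  have := hK' (n - j)
  gcongr

theorem tendsto_tsum_tripleCoeff {τ : ℂ} (hτ : τ.re < 0) (w : ℤ → ℂ)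
    (hw : Summable fun j : ℤ ↦ ‖Complex.exp (τ * (j * (j - 1) / 2)) * w j‖) :
    Tendsto (fun n ↦ ∑' j, tripleCoeff τ n j * w j) atTop
      (𝓝 ((∑' j : ℤ, (-1) ^ j * (Complex.exp (τ * (j * (j - 1) / 2)) * w j)) *
        (qPoch (Complex.exp τ) (Complex.exp τ))⁻¹)) := by
  obtain ⟨C, hC⟩ := exists_norm_qCentral_le (norm_cexp_lt_one hτ)
  rw [← tsum_mul_right]
  refine tendsto_tsum_of_dominated_convergence (hw.mul_left C) (fun j ↦ ?_)
    (.of_forall fun n j ↦ ?_)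
  · have := (tendsto_qCentral (norm_cexp_lt_one hτ) j).const_mul
      ((-1) ^ j * (Complex.exp (τ * (j * (j - 1) / 2)) * w j))
    refine this.congr fun n ↦ ?_
    rw [tripleCoeff]; ring
  · rw [tripleCoeff, show (-1) ^ j * Complex.exp (τ * (j * (j - 1) / 2)) *
      qCentral (Complex.exp τ) n j * w j = qCentral (Complex.exp τ) n j *
      ((-1) ^ j * (Complex.exp (τ * (j * (j - 1) / 2)) * w j)) by ring, norm_mul,
      norm_mul ((-1 : ℂ) ^ j), norm_neg_one_zpow, one_mul]
    exact mul_le_mul_of_nonneg_right (hC n j) (norm_nonneg _)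

/-- The theta series `∑ (-1)ⁿ q^(n(n-1)/2) zⁿ` for `q = exp τ`, `z = exp σ`. -/
noncomputable def thetaSeries (τ σ : ℂ) : ℂ :=
  ∑' n : ℤ, (-1) ^ n * Complex.exp (τ * (n * (n - 1) / 2) + σ * n)

theorem summable_norm_theta_weight (k : ℕ) {τ : ℂ} (hτ : τ.re < 0) (σ : ℂ) :
    Summable fun n : ℤ ↦ ‖(n : ℂ) ^ k * Complex.exp (τ * (n * (n - 1) / 2) + σ * n)‖ := by
  refine (summable_norm_pow_mul_cexp_quadratic k (a := τ / 2) (by simp; linarith)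
    (σ - τ / 2) 0).congr fun n ↦ ?_
  congr 3; ring

/-- The Jacobi triple product identity. -/
theorem thetaSeries_eq {τ : ℂ} (hτ : τ.re < 0) (σ : ℂ) :
    thetaSeries τ σ = qPoch (Complex.exp τ) (Complex.exp τ) *
      (qPoch (Complex.exp σ) (Complex.exp τ) *
        qPoch (Complex.exp τ / Complex.exp σ) (Complex.exp τ)) := by
  have hq := norm_cexp_lt_one hτ
  have e (j : ℤ) : Complex.exp (τ * (j * (j - 1) / 2)) * Complex.exp σ ^ j =
      Complex.exp (τ * (j * (j - 1) / 2) + σ * j) := by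
    rw [← Complex.exp_int_mul, ← Complex.exp_add]; congr 1; ring
  have h1 := tendsto_tsum_tripleCoeff hτ (fun j ↦ Complex.exp σ ^ j) (by
    simpa only [e, pow_zero, one_mul] using summable_norm_theta_weight 0 hτ σ)
  have h2 := (tendsto_qPoch (Complex.exp σ) hq).mul
    (tendsto_qPoch (Complex.exp τ / Complex.exp σ) hq)
  have h3 := tendsto_nhds_unique h1
    (h2.congr fun n ↦ (hasSum_tripleCoeff hτ (Complex.exp_ne_zero σ) n).tsum_eq.symm)
  simp only [e] at h3
  rw [← h3, thetaSeries]
  field_simp [qPoch_self_ne_zero hq]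

theorem qPoch_one {q : ℂ} (hq : ‖q‖ < 1) : qPoch 1 q = 0 := by
  refine tendsto_nhds_unique ((tendsto_qPoch 1 hq).comp (tendsto_add_atTop_nat 1))
    (tendsto_const_nhds.congr fun n ↦ ?_)
  simp [Finset.prod_range_succ']

theorem thetaSeries_zero {τ : ℂ} (hτ : τ.re < 0) : thetaSeries τ 0 = 0 := by
  rw [thetaSeries_eq hτ, Complex.exp_zero, qPoch_one (norm_cexp_lt_one hτ)]
  simp

/-- Jacobi's identity for the cube of Euler's product. -/
theorem tsum_jacobi_cube {τ : ℂ} (hτ : τ.re < 0) :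
    ∑' n : ℤ, (-1) ^ n * ((2 * n - 1) * Complex.exp (τ * (n * (n - 1) / 2))) =
      -2 * qPoch (Complex.exp τ) (Complex.exp τ) ^ 3 := by
  have hq := norm_cexp_lt_one hτ
  have hs (k : ℕ) : Summable fun n : ℤ ↦
      ‖(n : ℂ) ^ k * Complex.exp (τ * (n * (n - 1) / 2))‖ := by
    simpa using summable_norm_theta_weight k hτ 0
  have h1 := (tendsto_tsum_tripleCoeff hτ (fun j ↦ (j : ℂ))
    ((hs 1).congr fun n ↦ by rw [pow_one, mul_comm])).comp (tendsto_add_atTop_nat 1)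
  have h2 := ((tendsto_qFac hq).mul ((tendsto_qFac hq).comp (tendsto_add_atTop_nat 1))).neg
  have h3 := tendsto_nhds_unique h1
    (h2.congr fun n ↦ (hasSum_mul_tripleCoeff hτ n).tsum_eq.symm)
  have h4 : ∑' n : ℤ, (-1) ^ n * Complex.exp (τ * (n * (n - 1) / 2)) = 0 := by
    simpa [thetaSeries] using thetaSeries_zero hτ
  have hs' (k : ℕ) : Summable fun n : ℤ ↦
      (-1) ^ n * ((n : ℂ) ^ k * Complex.exp (τ * (n * (n - 1) / 2))) :=
    .of_norm ((hs k).congr fun n ↦ by rw [norm_mul ((-1 : ℂ) ^ n), norm_neg_one_zpow, one_mul])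
  have h5 : ∑' n : ℤ, (-1) ^ n * ((2 * n - 1) * Complex.exp (τ * (n * (n - 1) / 2))) =
      2 * ∑' n : ℤ, (-1) ^ n * (Complex.exp (τ * (n * (n - 1) / 2)) * n) -
        ∑' n : ℤ, (-1) ^ n * Complex.exp (τ * (n * (n - 1) / 2)) := by
    rw [← tsum_mul_left, ← Summable.tsum_sub]
    · exact tsum_congr fun n ↦ by ring
    · exact ((hs' 1).mul_left 2).congr fun n ↦ by ring
    · exact (hs' 0).congr fun n ↦ by ring
  have h6 := qPoch_self_ne_zero hq
  rw [h5, h4, sub_zero, (mul_inv_eq_iff_eq_mul₀ h6).1 h3]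
  ring

theorem neg_one_zpow_congr {a b : ℤ} (c : ℤ) (h : a = b + 2 * c) :
    (-1 : ℂ) ^ a = (-1) ^ b := by
  rw [h, zpow_add₀ (by norm_num), zpow_mul]; simp

theorem sign_cexp_congr {a b : ℤ} {x y : ℂ} (c : ℤ) (h : a = b + 2 * c) (hxy : x = y) :
    (-1 : ℂ) ^ a * Complex.exp x = (-1) ^ b * Complex.exp y := by
  rw [neg_one_zpow_congr c h, hxy]

theorem sign_cexp_congr_neg {a b : ℤ} {x y : ℂ} (c : ℤ) (h : a = b + 2 * c + 1) (hxy : x = y) :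
    (-1 : ℂ) ^ a * Complex.exp x = -((-1) ^ b * Complex.exp y) := by
  rw [neg_one_zpow_congr (b := b + 1) c (by rw [h]; ring), hxy, zpow_add_one₀ (by norm_num)]
  ring

theorem sign_cexp_mul (a b : ℤ) (x y : ℂ) :
    (-1 : ℂ) ^ a * Complex.exp x * ((-1) ^ b * Complex.exp y) =
      (-1) ^ (a + b) * Complex.exp (x + y) := by
  rw [zpow_add₀ (by norm_num), Complex.exp_add]
  ring

/-- Splitting a sum over `ℤ × β` along the residue of the first coordinate modulo `N`. -/
theorem tsum_int_prod_eq_sum {α β : Type*} (N : ℕ) [NeZero N] (e : ℤ × β ≃ α) {G : α → ℂ}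
    (hG : Summable G) :
    ∑' p, G p = ∑ c : Fin N, ∑' p : ℤ × β, G (e (p.1 * N + (c : ℕ), p.2)) := by
  let e1 : Fin N × (ℤ × β) ≃ ℤ × β :=
    (Equiv.prodAssoc _ _ _).symm.trans (Equiv.prodCongr
      ((Equiv.prodComm _ _).trans (Int.divModEquiv N).symm) (Equiv.refl β))
  have h1 : Summable fun x ↦ G ((e1.trans e) x) := (e1.trans e).summable_iff.2 hG
  refine ((e1.trans e).tsum_eq G).symm.trans ((Summable.tsum_prod h1).trans ?_)
  rw [tsum_fintype]
  refine Finset.sum_congr rfl fun c _ ↦ tsum_congr fun p ↦ ?_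
  simp [e1, Int.divModEquiv]

theorem tsum_int_eq_sum (N : ℕ) [NeZero N] {g : ℤ → ℂ} (hg : Summable g) :
    ∑' n, g n = ∑ c : Fin N, ∑' n : ℤ, g (n * N + (c : ℕ)) := by
  refine (tsum_int_prod_eq_sum N (Equiv.prodPUnit.{0} ℤ) hg).trans ?_
  exact Finset.sum_congr rfl fun c _ ↦
    (Equiv.prodPUnit ℤ).tsum_eq fun n ↦ g (n * N + (c : ℕ))

theorem summable_norm_theta_term {τ : ℂ} (hτ : τ.re < 0) {a : ℝ} (ha : 0 < a) (b c : ℂ) :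
    Summable fun n : ℤ ↦ ‖(-1 : ℂ) ^ n * Complex.exp (τ * (a * n ^ 2) + b * n + c)‖ := by
  refine (summable_norm_theta 0 (a := τ * a) ?_ b c).congr fun n ↦ ?_
  · rw [Complex.re_mul_ofReal]; exact mul_neg_of_neg_of_pos hτ ha
  · rw [pow_zero, one_mul, mul_assoc]

theorem summable_norm_thetaSeries {τ : ℂ} (hτ : τ.re < 0) (σ : ℂ) :
    Summable fun n : ℤ ↦ ‖(-1 : ℂ) ^ n * Complex.exp (τ * (n * (n - 1) / 2) + σ * n)‖ := by
  refine (summable_norm_theta_term hτ (a := 1 / 2) (by norm_num) (σ - τ / 2) 0).congr fun n ↦ ?_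
  congr 3; push_cast; ring

/-- The pentagonal number theorem. -/
theorem qPoch_self_eq_tsum {τ : ℂ} (hτ : τ.re < 0) :
    qPoch (Complex.exp τ) (Complex.exp τ) =
      ∑' n : ℤ, (-1) ^ n * Complex.exp (τ * (n * (3 * n - 1) / 2)) := by
  have h := thetaSeries_eq (τ := 3 * τ) (by simp; linarith) τ
  have e2 : Complex.exp (3 * τ) = Complex.exp τ ^ 3 := by
    rw [← Complex.exp_nat_mul]; norm_num
  rw [thetaSeries, e2, show Complex.exp τ ^ 3 / Complex.exp τ = Complex.exp τ * Complex.exp τ by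
    field_simp [Complex.exp_ne_zero]] at h
  rw [qPoch_eq_prod _ (norm_cexp_lt_one hτ) three_ne_zero]
  simp only [Finset.prod_range_succ, Finset.prod_range_zero, pow_zero, pow_one, mul_one, one_mul]
  rw [← pow_succ']
  rw [show ∑' n : ℤ, (-1) ^ n * Complex.exp (τ * (n * (3 * n - 1) / 2)) =
    ∑' n : ℤ, (-1) ^ n * Complex.exp (3 * τ * (n * (n - 1) / 2) + τ * n) from
    tsum_congr fun n ↦ by congr 2; ring, h]
  ring

/-- The bilateral series in the quintuple product identity. -/
noncomputable def quintSeries (τ σ : ℂ) : ℂ :=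
  ∑' n : ℤ, (-1) ^ n * Complex.exp (τ * (n * (3 * n - 1) / 2) + 3 * σ * n) +
    ∑' n : ℤ, (-1) ^ n * Complex.exp (τ * (n * (3 * n + 1) / 2) + 3 * σ * n + σ)

theorem summable_norm_quintSeries_left {τ : ℂ} (hτ : τ.re < 0) (σ : ℂ) : Summable fun n : ℤ ↦
    ‖(-1 : ℂ) ^ n * Complex.exp (τ * (n * (3 * n - 1) / 2) + 3 * σ * n)‖ := by
  refine (summable_norm_theta_term hτ (a := 3 / 2) (by norm_num)
    (3 * σ - τ / 2) 0).congr fun n ↦ ?_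
  congr 3; push_cast; ring

theorem summable_norm_quintSeries_right {τ : ℂ} (hτ : τ.re < 0) (σ : ℂ) : Summable fun n : ℤ ↦
    ‖(-1 : ℂ) ^ n * Complex.exp (τ * (n * (3 * n + 1) / 2) + 3 * σ * n + σ)‖ := by
  refine (summable_norm_theta_term hτ (a := 3 / 2) (by norm_num)
    (3 * σ + τ / 2) σ).congr fun n ↦ ?_
  congr 3; push_cast; ring

/-- The equivalence `(k, n) ↦ (k + a n + b, n)`. -/
def shearEquiv (a b : ℤ) : ℤ × ℤ ≃ ℤ × ℤ where
  toFun x := (x.1 + a * x.2 + b, x.2)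
  invFun x := (x.1 - a * x.2 - b, x.2)
  left_inv x := by ext <;> simp; ring
  right_inv x := by ext <;> simp; ring

/-- The equivalence `(p, n) ↦ (p, p - n)`. -/
def shearNegEquiv : ℤ × ℤ ≃ ℤ × ℤ where
  toFun x := (x.1, x.1 - x.2)
  invFun x := (x.1, x.1 - x.2)
  left_inv x := by ext <;> simp
  right_inv x := by ext <;> simp

/-- The quintuple product identity. -/
theorem thetaSeries_mul_quintSeries {τ : ℂ} (hτ : τ.re < 0) (σ : ℂ) :
    thetaSeries τ σ * quintSeries τ σ =
      qPoch (Complex.exp τ) (Complex.exp τ) * thetaSeries τ (2 * σ) := by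
  have ht := summable_norm_thetaSeries hτ σ
  have hl := summable_norm_quintSeries_left hτ σ
  have hr := summable_norm_quintSeries_right hτ σ
  have hp : Summable fun n : ℤ ↦ ‖(-1 : ℂ) ^ n * Complex.exp (τ * (n * (3 * n - 1) / 2))‖ := by
    simpa using summable_norm_quintSeries_left hτ 0
  have ht2 := summable_norm_thetaSeries hτ (2 * σ)
  rw [qPoch_self_eq_tsum hτ, quintSeries, mul_add]
  simp only [thetaSeries]
  rw [tsum_mul_tsum_of_summable_norm ht hl, tsum_mul_tsum_of_summable_norm ht hr,
    tsum_mul_tsum_of_summable_norm hp ht2,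
    tsum_int_prod_eq_sum 2 (shearEquiv (-3) 0) (summable_mul_of_summable_norm ht hl),
    tsum_int_prod_eq_sum 2 (shearEquiv (-3) (-1)) (summable_mul_of_summable_norm ht hr),
    tsum_int_prod_eq_sum 2 (shearEquiv 1 0) (summable_mul_of_summable_norm hp ht2)]
  simp only [Fin.sum_univ_two, shearEquiv, Equiv.coe_fn_mk, sign_cexp_mul]
  have key : ∀ a b c d e f : ℂ, a = e → c = f → b = -d → a + b + (c + d) = e + f := by
    rintro a b c d e f rfl rfl rfl; ring
  refine key _ _ _ _ _ _ ?_ ?_ ?_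
  · refine (tsum_congr fun p ↦ ?_).trans
      (((Equiv.prodComm ℤ ℤ).trans ((Equiv.neg ℤ).prodCongr (Equiv.refl ℤ))).tsum_eq _)
    refine sign_cexp_congr 0 ?_ ?_
    · simp; ring
    · simp; ring
  · refine (tsum_congr fun p ↦ ?_).trans
      (((Equiv.prodComm ℤ ℤ).trans (shearEquiv (-1) 0)).tsum_eq _)
    refine sign_cexp_congr (p.1 - 2 * p.2 - 1) ?_ ?_
    · simp [shearEquiv]; ring
    · simp [shearEquiv]; ring
  · rw [← tsum_neg]
    refine (tsum_congr fun p ↦ ?_).trans (shearNegEquiv.tsum_eq _)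
    refine sign_cexp_congr_neg (p.1 - 2 * p.2) ?_ ?_
    · simp [shearNegEquiv]; ring
    · simp [shearNegEquiv]; ring

theorem pow_sub_pow_eq_prod_range {n : ℕ} (hn : 0 < n) {ζ : ℂ} (hζ : IsPrimitiveRoot ζ n)
    (a b : ℂ) : ∏ j ∈ Finset.range n, (a - ζ ^ j * b) = a ^ n - b ^ n := by
  have h := congrArg (Polynomial.eval a) (X_pow_sub_C_eq_prod hζ hn (rfl : b ^ n = b ^ n))
  simpa [Polynomial.eval_prod] using h.symm

theorem thetaSeries_sub {τ : ℂ} (hτ : τ.re < 0) (σ : ℂ) :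
    thetaSeries τ (τ - σ) = thetaSeries τ σ := by
  rw [thetaSeries_eq hτ, thetaSeries_eq hτ, Complex.exp_sub]
  field_simp [Complex.exp_ne_zero]

theorem five_mul_re_neg {τ : ℂ} (hτ : τ.re < 0) : (5 * τ).re < 0 := by
  simp; linarith

/-- The 5-dissection of Euler's product. -/
theorem qPoch_self_eq_dissection {τ : ℂ} (hτ : τ.re < 0) :
    qPoch (Complex.exp τ) (Complex.exp τ) = quintSeries (25 * τ) (5 * τ) -
      Complex.exp τ * qPoch (Complex.exp (25 * τ)) (Complex.exp (25 * τ)) -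
      Complex.exp τ ^ 2 * quintSeries (25 * τ) (10 * τ) := by
  have hT : (25 * τ).re < 0 := by simp; linarith
  have hs : Summable fun n : ℤ ↦ (-1 : ℂ) ^ n * Complex.exp (τ * (n * (3 * n - 1) / 2)) :=
    .of_norm (by simpa using summable_norm_quintSeries_left hτ 0)
  have key : ∀ s0 s1 s2 s3 s4 a b c d e x y : ℂ, s0 = a → s1 = -(x * c) → s2 = b →
      s3 = -(y * e) → s4 = -(y * d) →
      s0 + s1 + s2 + s3 + s4 = a + b - x * c - y * (d + e) := by
    rintro _ _ _ _ _ a b c d e x y rfl rfl rfl rfl rfl; ring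
  rw [qPoch_self_eq_tsum hτ, tsum_int_eq_sum 5 hs, qPoch_self_eq_tsum hT, quintSeries, quintSeries]
  simp only [Fin.sum_univ_five]
  refine key _ _ _ _ _ _ _ _ _ _ _ _ ?_ ?_ ?_ ?_ ?_
  · refine (tsum_congr fun p ↦ ?_).trans ((Equiv.neg ℤ).tsum_eq _)
    refine sign_cexp_congr (3 * p) ?_ ?_
    · simp; ring
    · simp; ring
  · rw [← tsum_mul_left, ← tsum_neg]
    refine (tsum_congr fun p ↦ ?_).trans ((Equiv.neg ℤ).tsum_eq _)
    rw [mul_left_comm, ← Complex.exp_add]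
    refine sign_cexp_congr_neg (3 * p) ?_ ?_
    · simp; ring
    · simp; ring
  · refine tsum_congr fun p ↦ ?_
    refine sign_cexp_congr (2 * p + 1) ?_ ?_
    · simp; ring
    · simp; ring
  · rw [← tsum_mul_left, ← tsum_neg]
    refine tsum_congr fun p ↦ ?_
    rw [mul_left_comm, ← Complex.exp_nat_mul, ← Complex.exp_add]
    refine sign_cexp_congr_neg (2 * p + 1) ?_ ?_
    · simp; ring
    · simp; ring
  · rw [← tsum_mul_left, ← tsum_neg]
    refine (tsum_congr fun p ↦ ?_).trans (((Equiv.neg ℤ).trans (Equiv.subRight 1)).tsum_eq _)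
    rw [mul_left_comm, ← Complex.exp_nat_mul, ← Complex.exp_add]
    refine sign_cexp_congr_neg (3 * p + 2) ?_ ?_
    · simp; ring
    · simp; ring

/-- The first of the two theta products whose quotient is the Rogers–Ramanujan continued
fraction, `(q; q⁵)(q⁴; q⁵)(q⁵; q⁵)`. -/
noncomputable def rrNum (q : ℂ) : ℂ :=
  qPoch (q ^ 5) (q ^ 5) * (qPoch q (q ^ 5) * qPoch (q ^ 4) (q ^ 5))

/-- The product `(q²; q⁵)(q³; q⁵)(q⁵; q⁵)`. -/
noncomputable def rrDen (q : ℂ) : ℂ :=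
  qPoch (q ^ 5) (q ^ 5) * (qPoch (q ^ 2) (q ^ 5) * qPoch (q ^ 3) (q ^ 5))

theorem rrNum_exp {τ : ℂ} (hτ : τ.re < 0) :
    rrNum (Complex.exp τ) = thetaSeries (5 * τ) τ := by
  rw [thetaSeries_eq (five_mul_re_neg hτ), rrNum, ← Complex.exp_sub]
  simp only [← Complex.exp_nat_mul]
  push_cast; ring_nf

theorem rrDen_exp {τ : ℂ} (hτ : τ.re < 0) :
    rrDen (Complex.exp τ) = thetaSeries (5 * τ) (2 * τ) := by
  rw [thetaSeries_eq (five_mul_re_neg hτ), rrDen, ← Complex.exp_sub]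
  simp only [← Complex.exp_nat_mul]
  push_cast; ring_nf

theorem norm_pow_lt_one {q : ℂ} (hq : ‖q‖ < 1) {n : ℕ} (hn : n ≠ 0) : ‖q ^ n‖ < 1 := by
  rw [norm_pow]; exact pow_lt_one₀ (norm_nonneg _) hq hn

theorem qPoch_self_eq_five {q : ℂ} (hq : ‖q‖ < 1) :
    qPoch q q = qPoch q (q ^ 5) * qPoch (q ^ 2) (q ^ 5) * qPoch (q ^ 3) (q ^ 5) *
      qPoch (q ^ 4) (q ^ 5) * qPoch (q ^ 5) (q ^ 5) := by
  rw [qPoch_eq_prod q hq (N := 5) (by norm_num)]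
  simp only [Finset.prod_range_succ, Finset.prod_range_zero, one_mul]
  ring_nf

theorem rrNum_mul_rrDen {q : ℂ} (hq : ‖q‖ < 1) :
    rrNum q * rrDen q = qPoch q q * qPoch (q ^ 5) (q ^ 5) := by
  rw [qPoch_self_eq_five hq, rrNum, rrDen]; ring

theorem qPoch_mul_qPoch_eq {y : ℂ} (hy : ‖y‖ < 1) (hy0 : y ≠ 0) :
    qPoch y y * qPoch (y ^ 5) (y ^ 5) =
      rrDen (y ^ 5) ^ 2 - y * (rrNum (y ^ 5) * rrDen (y ^ 5)) - y ^ 2 * rrNum (y ^ 5) ^ 2 := by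
  obtain ⟨τ, rfl⟩ : ∃ τ, Complex.exp τ = y := ⟨_, Complex.exp_log hy0⟩
  have hτ : τ.re < 0 := by rwa [Complex.norm_exp, Real.exp_lt_one_iff] at hy
  have hS := five_mul_re_neg hτ
  have hT : (25 * τ).re < 0 := by simp; linarith
  have e5 : Complex.exp τ ^ 5 = Complex.exp (5 * τ) := by
    rw [← Complex.exp_nat_mul]; norm_num
  have e25 : Complex.exp (5 * τ) ^ 5 = Complex.exp (25 * τ) := by
    rw [← Complex.exp_nat_mul]; congr 1; push_cast; ring
  have hAB := rrNum_mul_rrDen (norm_cexp_lt_one hS)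
  have h1 := thetaSeries_mul_quintSeries hT (5 * τ)
  have h2 := thetaSeries_mul_quintSeries hT (10 * τ)
  have hA := rrNum_exp hS
  have hB := rrDen_exp hS
  have h0 := qPoch_self_ne_zero (norm_cexp_lt_one hT)
  rw [e25] at hAB
  rw [show 2 * (10 * τ) = 25 * τ - 5 * τ by ring, thetaSeries_sub hT] at h2
  rw [show 5 * (5 * τ) = 25 * τ by ring] at hA hB
  rw [show 2 * (5 * τ) = 10 * τ by ring] at hB h1
  rw [← hA, ← hB] at h1
  rw [← hA, ← hB] at h2
  rw [e5]
  refine mul_right_cancel₀ h0 ?_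
  rw [mul_assoc, ← hAB, qPoch_self_eq_dissection hτ]
  linear_combination rrDen (Complex.exp (5 * τ)) * h1 -
    Complex.exp τ ^ 2 * rrNum (Complex.exp (5 * τ)) * h2

theorem prod_qPoch_root {ζ : ℂ} (hζ : IsPrimitiveRoot ζ 5) (a : ℂ) {x : ℂ} (hx : ‖x‖ < 1) :
    ∏ j ∈ Finset.range 5, qPoch (ζ ^ j * a) x = qPoch (a ^ 5) (x ^ 5) := by
  simp only [qPoch]
  rw [← Multipliable.tprod_finsetProd fun j _ ↦ multipliable_qPoch _ hx]
  refine tprod_congr fun n ↦ ?_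
  simp only [mul_assoc]
  rw [pow_sub_pow_eq_prod_range (by norm_num) hζ, one_pow, mul_pow, ← pow_mul, ← pow_mul,
    mul_comm n]

theorem prod_qPoch_self_root {ζ : ℂ} (hζ : IsPrimitiveRoot ζ 5) {y : ℂ} (hy : ‖y‖ < 1) :
    (∏ j ∈ Finset.range 5, qPoch (ζ ^ j * y) (ζ ^ j * y)) * qPoch (y ^ 25) (y ^ 25) =
      qPoch (y ^ 5) (y ^ 5) ^ 6 := by
  have hn (j : ℕ) : ‖ζ ^ j * y‖ < 1 := by
    rw [norm_mul, norm_pow, hζ.norm'_eq_one (by norm_num), one_pow, one_mul]; exact hy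
  have hpow (j k : ℕ) : (ζ ^ j * y) ^ k = (ζ ^ k) ^ j * y ^ k := by
    rw [mul_pow, ← pow_mul, ← pow_mul, mul_comm j]
  have hx := norm_pow_lt_one hy (n := 5) (by norm_num)
  have hp (k : ℕ) (hk : Nat.Coprime k 5) :
      ∏ j ∈ Finset.range 5, qPoch ((ζ ^ k) ^ j * y ^ k) (y ^ 5) =
        qPoch ((y ^ 5) ^ k) ((y ^ 5) ^ 5) := by
    rw [prod_qPoch_root (hζ.pow_of_coprime k hk) _ hx, ← pow_mul y k, ← pow_mul y 5 k, mul_comm k]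
  rw [Finset.prod_congr rfl fun j _ ↦ qPoch_self_eq_five (hn j)]
  simp only [Finset.prod_mul_distrib, hpow, hζ.pow_eq_one, one_pow, one_mul]
  have h1 := hp 1 (by norm_num)
  simp only [pow_one] at h1
  rw [hp 2 (by norm_num), hp 3 (by norm_num), hp 4 (by norm_num), h1, Finset.prod_const,
    Finset.card_range, show y ^ 25 = (y ^ 5) ^ 5 by ring, pow_succ _ 5]
  linear_combination -qPoch (y ^ 5) (y ^ 5) ^ 5 * qPoch_self_eq_five hx

theorem prod_rr_root {ζ : ℂ} (hζ : IsPrimitiveRoot ζ 5) (A B y : ℂ) :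
    ∏ j ∈ Finset.range 5, (B ^ 2 - ζ ^ j * y * (A * B) - (ζ ^ j * y) ^ 2 * A ^ 2) =
      B ^ 10 - 11 * y ^ 5 * (A * B) ^ 5 - y ^ 10 * A ^ 10 := by
  obtain ⟨s, hs⟩ : ∃ s : ℂ, s ^ 2 = 5 := ⟨_, Complex.cpow_nat_inv_pow 5 two_ne_zero⟩
  have h1 := pow_sub_pow_eq_prod_range (by norm_num) hζ B ((1 + s) / 2 * (y * A))
  have h2 := pow_sub_pow_eq_prod_range (by norm_num) hζ B ((1 - s) / 2 * (y * A))
  have h3 : (1 + s) / 2 * ((1 - s) / 2) = -1 := by linear_combination -hs / 4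
  have hf (j : ℕ) : B ^ 2 - ζ ^ j * y * (A * B) - (ζ ^ j * y) ^ 2 * A ^ 2 =
      (B - ζ ^ j * ((1 + s) / 2 * (y * A))) * (B - ζ ^ j * ((1 - s) / 2 * (y * A))) := by
    linear_combination -(ζ ^ j * y * A) ^ 2 * h3
  simp only [hf, Finset.prod_mul_distrib]
  have h4 : (1 + s) ^ 5 + (1 - s) ^ 5 = 352 := by
    linear_combination (10 * s ^ 2 + 70) * hs
  rw [h1, h2]
  have h5 : ((1 + s) / 2 * ((1 - s) / 2)) ^ 5 = -1 := by rw [h3]; norm_num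
  linear_combination (y * A) ^ 10 * h5 - B ^ 5 * (y * A) ^ 5 / 32 * h4

/-- Ramanujan's identity relating the fifth power of the Rogers–Ramanujan continued fraction to
Euler's product. -/
theorem qPoch_pow_eleven {x : ℂ} (hx : ‖x‖ < 1) (hx0 : x ≠ 0) :
    qPoch x x ^ 11 = qPoch (x ^ 5) (x ^ 5) *
      (rrDen x ^ 10 - 11 * x * (rrNum x * rrDen x) ^ 5 - x ^ 2 * rrNum x ^ 10) := by
  obtain ⟨y, rfl⟩ : ∃ y, y ^ 5 = x := ⟨_, Complex.cpow_nat_inv_pow x (n := 5) (by norm_num)⟩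
  have hζ := Complex.isPrimitiveRoot_exp 5 (by norm_num)
  set ζ := Complex.exp (2 * π * Complex.I / (5 : ℕ))
  have hy : ‖y‖ < 1 := by
    rw [norm_pow] at hx; exact (pow_lt_one_iff_of_nonneg (norm_nonneg _) (by norm_num)).1 hx
  have hy0 : y ≠ 0 := by rintro rfl; simp at hx0
  have h1 (j : ℕ) := qPoch_mul_qPoch_eq (y := ζ ^ j * y)
    (by rw [norm_mul, norm_pow, hζ.norm'_eq_one (by norm_num), one_pow, one_mul]; exact hy)
    (mul_ne_zero (pow_ne_zero _ (hζ.ne_zero (by norm_num))) hy0)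
  have h2 (j : ℕ) : (ζ ^ j * y) ^ 5 = y ^ 5 := by
    rw [mul_pow, ← pow_mul, mul_comm j, pow_mul, hζ.pow_eq_one, one_pow, one_mul]
  simp only [h2] at h1
  have h3 := prod_qPoch_self_root hζ hy
  have h4 := prod_rr_root hζ (rrNum (y ^ 5)) (rrDen (y ^ 5)) y
  simp only [← h1, Finset.prod_mul_distrib, Finset.prod_const, Finset.card_range] at h4
  rw [show y ^ 25 = (y ^ 5) ^ 5 by ring] at h3
  linear_combination -qPoch (y ^ 5) (y ^ 5) ^ 5 * h3 +
    qPoch ((y ^ 5) ^ 5) ((y ^ 5) ^ 5) * h4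

/-- The term `(-1)ⁿ (2n - 1)^p q^(n(n-1)/2)` of a weighted theta series, `q = exp τ`. -/
noncomputable def oddTerm (p : ℕ) (τ : ℂ) (n : ℤ) : ℂ :=
  (-1) ^ n * ((2 * n - 1) ^ p * Complex.exp (τ * (n * (n - 1) / 2)))

theorem summable_norm_sign_mul_exp {τ : ℂ} (hτ : τ.re < 0) {a : ℝ} (ha : 0 < a) (b : ℝ) (k : ℕ) :
    Summable fun n : ℤ ↦
      ‖(-1 : ℂ) ^ n * ((n : ℂ) ^ k * Complex.exp (τ * (a * n ^ 2 + b * n)))‖ := by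
  refine (summable_norm_theta k (a := τ * a) ?_ (τ * b) 0).congr fun n ↦ ?_
  · rw [Complex.re_mul_ofReal]; exact mul_neg_of_neg_of_pos hτ ha
  · congr 4; ring

theorem summable_norm_oddTerm {τ : ℂ} (hτ : τ.re < 0) {p : ℕ} (hp : p ≤ 2) :
    Summable fun n ↦ ‖oddTerm p τ n‖ := by
  have h (k : ℕ) := (summable_norm_sign_mul_exp hτ (a := 1 / 2) (by norm_num) (-1 / 2) k).of_norm
  have e (n : ℤ) : ((1 / 2 : ℝ) : ℂ) * (n : ℂ) ^ 2 + ((-1 / 2 : ℝ) : ℂ) * n = n * (n - 1) / 2 := by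
    push_cast; ring
  simp only [e] at h
  refine Summable.norm ?_
  interval_cases p
  · exact (h 0).congr fun n ↦ by rw [oddTerm]; ring
  · exact (((h 1).mul_left 2).sub (h 0)).congr fun n ↦ by rw [oddTerm]; ring
  · exact ((((h 2).mul_left 4).sub ((h 1).mul_left 4)).add (h 0)).congr fun n ↦ by
      rw [oddTerm]; ring

theorem hasSum_mul_prod {ι κ : Type*} {f : ι → ℂ} {g : κ → ℂ} (hf : Summable fun i ↦ ‖f i‖)
    (hg : Summable fun i ↦ ‖g i‖) :
    HasSum (fun z : ι × κ ↦ f z.1 * g z.2) ((∑' i, f i) * ∑' i, g i) := by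
  rw [tsum_mul_tsum_of_summable_norm hf hg]
  exact (summable_mul_of_summable_norm hf hg).hasSum

/-- The terms of the series for `rrNum`, differentiated `p ≤ 1` times. -/
noncomputable def rrNumTerm (p : ℕ) (τ : ℂ) (n : ℤ) : ℂ :=
  (-1) ^ n * (((5 * n - 3) * n / 2) ^ p * Complex.exp (τ * ((5 * n - 3) * n / 2)))

/-- The terms of the series for `rrDen`, differentiated `p ≤ 1` times. -/
noncomputable def rrDenTerm (p : ℕ) (τ : ℂ) (n : ℤ) : ℂ :=
  (-1) ^ n * (((5 * n - 1) * n / 2) ^ p * Complex.exp (τ * ((5 * n - 1) * n / 2)))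

theorem summable_norm_quadTerm {τ : ℂ} (hτ : τ.re < 0) {b : ℝ} {p : ℕ} (hp : p ≤ 1) :
    Summable fun n : ℤ ↦ ‖(-1 : ℂ) ^ n * (((5 * n - b) * n / 2) ^ p *
      Complex.exp (τ * ((5 * n - b) * n / 2)))‖ := by
  have h (k : ℕ) := (summable_norm_sign_mul_exp hτ (a := 5 / 2) (by norm_num) (-b / 2) k).of_norm
  have e (n : ℤ) : ((5 / 2 : ℝ) : ℂ) * (n : ℂ) ^ 2 + ((-b / 2 : ℝ) : ℂ) * n =
      (5 * n - b) * n / 2 := by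
    push_cast; ring
  simp only [e] at h
  refine Summable.norm ?_
  interval_cases p
  · exact (h 0).congr fun n ↦ by ring
  · exact (((h 2).mul_left (5 / 2)).sub ((h 1).mul_left ((b : ℂ) / 2))).congr fun n ↦ by ring

theorem summable_norm_rrNumTerm {τ : ℂ} (hτ : τ.re < 0) {p : ℕ} (hp : p ≤ 1) :
    Summable fun n ↦ ‖rrNumTerm p τ n‖ := by
  simpa only [Complex.ofReal_ofNat] using! summable_norm_quadTerm hτ (b := 3) hp

theorem summable_norm_rrDenTerm {τ : ℂ} (hτ : τ.re < 0) {p : ℕ} (hp : p ≤ 1) :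
    Summable fun n ↦ ‖rrDenTerm p τ n‖ := by
  simpa only [Complex.ofReal_one] using! summable_norm_quadTerm hτ (b := 1) hp

theorem sign_mul_congr {a b : ℤ} {x y v w : ℂ} (c : ℤ) (h : a = b + 2 * c) (hxy : x = y)
    (hvw : v = -8 * w) : (-1 : ℂ) ^ a * (Complex.exp x * v) =
      -8 * ((-1) ^ b * (Complex.exp y * w)) := by
  rw [neg_one_zpow_congr c h, hxy, hvw]; ring

theorem sign_mul_congr_neg {a b : ℤ} {x y v w : ℂ} (c : ℤ) (h : a = b + 2 * c + 1) (hxy : x = y)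
    (hvw : v = 8 * w) : (-1 : ℂ) ^ a * (Complex.exp x * v) =
      -8 * ((-1) ^ b * (Complex.exp y * w)) := by
  rw [neg_one_zpow_congr (b := b + 1) c (by rw [h]; ring), hxy, hvw, zpow_add_one₀ (by norm_num)]
  ring

/-- The lattice sum of the Wronskian of the two theta series of level five. -/
theorem tsum_lattice_eq {τ : ℂ} {H G : ℤ × ℤ → ℂ} (hG : Summable G)
    (hGe : ∀ z, G z = (-1) ^ (z.1 + z.2) *
      (Complex.exp (τ * (z.1 * (z.1 - 1) / 2 + z.2 * (z.2 - 1) / 2)) *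
      (3 * (2 * z.1 - 1) ^ 2 - 3 * (2 * z.2 - 1) ^ 2 - 8 * ((2 * z.1 - 1) * (2 * z.2 - 1)))))
    (hHe : ∀ z, H z = (-1) ^ (z.1 + z.2) *
      (Complex.exp (τ * ((5 * z.1 - 3) * z.1 / 2 + (5 * z.2 - 1) * z.2 / 2)) *
      (1 + 5 * ((5 * z.1 - 3) * z.1 / 2) - 5 * ((5 * z.2 - 1) * z.2 / 2)))) :
    ∑' z, G z = -32 * ∑' z, H z := by
  have key : ∀ s0 s1 s2 s3 s4 s : ℂ, s0 = -8 * s → s1 = -8 * s → s2 = -8 * s →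
      s3 = -8 * s → s4 = 0 → s0 + s1 + s2 + s3 + s4 = -32 * s := by
    rintro _ _ _ _ _ s rfl rfl rfl rfl rfl; ring
  rw [tsum_int_prod_eq_sum 5 (shearEquiv (-2) 0) hG]
  simp only [Fin.sum_univ_five, shearEquiv, Equiv.coe_fn_mk]
  refine key _ _ _ _ _ _ ?_ ?_ ?_ ?_ ?_
  · rw [← tsum_mul_left]
    let e : ℤ × ℤ ≃ ℤ × ℤ := ⟨fun z ↦ (z.1, 2 * z.1 - z.2), fun z ↦ (z.1, 2 * z.1 - z.2),
      fun z ↦ by ext <;> simp, fun z ↦ by ext <;> simp⟩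
    refine (tsum_congr fun z ↦ ?_).trans (e.tsum_eq _)
    rw [hGe, hHe]
    refine sign_mul_congr (z.1) ?_ ?_ ?_ <;> simp [e, -mul_eq_mul_left_iff] <;> ring
  · rw [← tsum_mul_left]
    let e : ℤ × ℤ ≃ ℤ × ℤ := ⟨fun z ↦ (z.2 - 2 * z.1, z.1), fun z ↦ (z.2, z.1 + 2 * z.2),
      fun z ↦ by ext <;> simp, fun z ↦ by ext <;> simp⟩
    refine (tsum_congr fun z ↦ ?_).trans (e.tsum_eq _)
    rw [hGe, hHe]
    refine sign_mul_congr_neg (3 * z.1 - z.2) ?_ ?_ ?_ <;> simp [e, -mul_eq_mul_left_iff] <;> ring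
  · rw [← tsum_mul_left]
    let e : ℤ × ℤ ≃ ℤ × ℤ := ⟨fun z ↦ (2 * z.1 - z.2 + 1, -z.1),
      fun z ↦ (-z.2, -2 * z.2 - z.1 + 1),
      fun z ↦ by ext <;> simp; ring, fun z ↦ by ext <;> simp; ring⟩
    refine (tsum_congr fun z ↦ ?_).trans (e.tsum_eq _)
    rw [hGe, hHe]
    refine sign_mul_congr_neg (2 * z.1) ?_ ?_ ?_ <;> simp [e, -mul_eq_mul_left_iff] <;> ring
  · rw [← tsum_mul_left]
    let e : ℤ × ℤ ≃ ℤ × ℤ := ⟨fun z ↦ (-z.1, z.2 - 2 * z.1 - 1),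
      fun z ↦ (-z.1, z.2 - 2 * z.1 + 1),
      fun z ↦ by ext <;> simp; ring, fun z ↦ by ext <;> simp; ring⟩
    refine (tsum_congr fun z ↦ ?_).trans (e.tsum_eq _)
    rw [hGe, hHe]
    refine sign_mul_congr (4 * z.1 - z.2 + 2) ?_ ?_ ?_ <;> simp [e, -mul_eq_mul_left_iff] <;> ring
  · let e : ℤ × ℤ ≃ ℤ × ℤ := ⟨fun z ↦ (2 * z.1 - z.2 + 1, 3 * z.1 - 2 * z.2 + 3),
      fun z ↦ (2 * z.1 - z.2 + 1, 3 * z.1 - 2 * z.2 + 3),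
      fun z ↦ by ext <;> simp <;> ring, fun z ↦ by ext <;> simp <;> ring⟩
    refine self_eq_neg.1 ?_
    rw [← tsum_neg]
    refine (tsum_congr fun z ↦ ?_).trans (e.tsum_eq _)
    rw [hGe, hGe, ← mul_neg, ← mul_neg]
    refine congrArg₂ _ (neg_one_zpow_congr (z.2 - z.1 - 1) ?_)
      (congrArg₂ _ (congrArg _ ?_) ?_) <;> simp [e, -mul_eq_mul_left_iff] <;> ring

theorem rrNum_wronskian_rrDen {τ : ℂ} (hτ : τ.re < 0) :
    (∑' n, rrNumTerm 0 τ n) * (∑' n, rrDenTerm 0 τ n) +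
      5 * ((∑' n, rrNumTerm 1 τ n) * (∑' n, rrDenTerm 0 τ n)) -
      5 * ((∑' n, rrNumTerm 0 τ n) * (∑' n, rrDenTerm 1 τ n)) =
      qPoch (Complex.exp τ) (Complex.exp τ) ^ 6 := by
  have hA (p : ℕ) (hp : p ≤ 1) := summable_norm_rrNumTerm hτ hp
  have hB (p : ℕ) (hp : p ≤ 1) := summable_norm_rrDenTerm hτ hp
  have hO (p : ℕ) (hp : p ≤ 2) := summable_norm_oddTerm hτ hp
  have hH := ((hasSum_mul_prod (hA 0 (by simp)) (hB 0 (by simp))).add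
    ((hasSum_mul_prod (hA 1 (by simp)) (hB 0 (by simp))).mul_left 5)).sub
    ((hasSum_mul_prod (hA 0 (by simp)) (hB 1 (by simp))).mul_left 5)
  have hG := (((hasSum_mul_prod (hO 2 (by simp)) (hO 0 (by simp))).mul_left 3).sub
    ((hasSum_mul_prod (hO 0 (by simp)) (hO 2 (by simp))).mul_left 3)).sub
    ((hasSum_mul_prod (hO 1 (by simp)) (hO 1 (by simp))).mul_left 8)
  have h := tsum_lattice_eq (τ := τ) (H := fun z ↦ rrNumTerm 0 τ z.1 * rrDenTerm 0 τ z.2 +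
      5 * (rrNumTerm 1 τ z.1 * rrDenTerm 0 τ z.2) - 5 * (rrNumTerm 0 τ z.1 * rrDenTerm 1 τ z.2))
      hG.summable (fun z ↦ by
      rw [mul_add, Complex.exp_add, zpow_add₀ (by norm_num)]
      simp only [oddTerm]; ring) (fun z ↦ by
      rw [mul_add, Complex.exp_add, zpow_add₀ (by norm_num)]
      simp only [rrNumTerm, rrDenTerm]; ring)
  rw [hG.tsum_eq, hH.tsum_eq] at h
  have hJ : ∑' n, oddTerm 1 τ n = _ := (tsum_congr fun n ↦ by simp [oddTerm]).trans
    (tsum_jacobi_cube hτ)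
  rw [hJ] at h
  linear_combination h / 32

theorem hasDerivAt_tsum_quadTerm {b : ℝ} (hb0 : 0 ≤ b) (hb5 : b ≤ 5) {τ : ℂ} (hτ : τ.re < 0) :
    HasDerivAt (fun τ : ℂ ↦ ∑' n : ℤ, (-1 : ℂ) ^ n * (((5 * n - b) * n / 2) ^ 0 *
      Complex.exp (τ * ((5 * n - b) * n / 2))))
      (∑' n : ℤ, (-1 : ℂ) ^ n * (((5 * n - b) * n / 2) ^ 1 *
      Complex.exp (τ * ((5 * n - b) * n / 2)))) τ := by
  have hc (n : ℤ) : 0 ≤ (5 * n - b) * n / 2 := by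
    rcases le_or_gt n 0 with h | h
    · have : (n : ℝ) ≤ 0 := by exact_mod_cast h
      nlinarith
    · have : (1 : ℝ) ≤ n := by exact_mod_cast h
      nlinarith
  have hcast (n : ℤ) : (5 * n - b) * n / 2 = (((5 * n - b) * n / 2 : ℝ) : ℂ) := by
    push_cast; ring
  have hε : ((τ.re / 2 : ℝ) : ℂ).re < 0 := by rw [Complex.ofReal_re]; linarith
  have hd (n : ℤ) (y : ℂ) : HasDerivAt (fun τ : ℂ ↦ (-1 : ℂ) ^ n * (((5 * n - b) * n / 2) ^ 0 *
      Complex.exp (τ * ((5 * n - b) * n / 2)))) ((-1 : ℂ) ^ n * (((5 * n - b) * n / 2) ^ 1 *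
      Complex.exp (y * ((5 * n - b) * n / 2)))) y := by
    simp only [pow_zero, one_mul, pow_one]
    refine HasDerivAt.const_mul _ ?_
    rw [mul_comm _ (Complex.exp _)]
    exact (hasDerivAt_mul_const _).cexp
  have hb (n : ℤ) (y : ℂ) (hy : y.re < τ.re / 2) : ‖(-1 : ℂ) ^ n * (((5 * n - b) * n / 2) ^ 1 *
      Complex.exp (y * ((5 * n - b) * n / 2)))‖ ≤ ‖(-1 : ℂ) ^ n * (((5 * n - b) * n / 2) ^ 1 *
      Complex.exp ((τ.re / 2 : ℝ) * ((5 * n - b) * n / 2)))‖ := by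
    rw [hcast n]
    simp only [norm_mul, norm_neg_one_zpow, one_mul, Complex.norm_exp]
    rw [Complex.re_mul_ofReal, Complex.re_mul_ofReal, Complex.ofReal_re]
    have := mul_le_mul_of_nonneg_right hy.le (hc n)
    gcongr
  exact hasDerivAt_tsum_of_isPreconnected (summable_norm_quadTerm hε (b := b) le_rfl)
    (isOpen_Iio.preimage Complex.continuous_re) (convex_halfSpace_re_lt _).isPreconnected
    (fun n y _ ↦ hd n y) hb (y₀ := τ) (show τ.re < τ.re / 2 by linarith)
    (summable_norm_quadTerm hτ (b := b) zero_le_one).of_norm (show τ.re < τ.re / 2 by linarith)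

theorem tsum_rrNumTerm {τ : ℂ} (hτ : τ.re < 0) :
    ∑' n, rrNumTerm 0 τ n = rrNum (Complex.exp τ) := by
  rw [rrNum_exp hτ, thetaSeries]
  refine tsum_congr fun n ↦ ?_
  rw [rrNumTerm, pow_zero, one_mul]; congr 2; ring

theorem tsum_rrDenTerm {τ : ℂ} (hτ : τ.re < 0) :
    ∑' n, rrDenTerm 0 τ n = rrDen (Complex.exp τ) := by
  rw [rrDen_exp hτ, thetaSeries]
  refine tsum_congr fun n ↦ ?_
  rw [rrDenTerm, pow_zero, one_mul]; congr 2; ring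

theorem eventually_re_neg {τ : ℂ} (hτ : τ.re < 0) : ∀ᶠ z : ℂ in 𝓝 τ, z.re < 0 :=
  (isOpen_Iio.preimage Complex.continuous_re).mem_nhds hτ

theorem hasDerivAt_rrNum {τ : ℂ} (hτ : τ.re < 0) :
    HasDerivAt (fun τ ↦ rrNum (Complex.exp τ)) (∑' n, rrNumTerm 1 τ n) τ := by
  have h := hasDerivAt_tsum_quadTerm (b := 3) (by norm_num) (by norm_num) hτ
  simp only [Complex.ofReal_ofNat] at h
  exact h.congr_of_eventuallyEq
    ((eventually_re_neg hτ).mono fun z hz ↦ (tsum_rrNumTerm hz).symm)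

theorem hasDerivAt_rrDen {τ : ℂ} (hτ : τ.re < 0) :
    HasDerivAt (fun τ ↦ rrDen (Complex.exp τ)) (∑' n, rrDenTerm 1 τ n) τ := by
  have h := hasDerivAt_tsum_quadTerm (b := 1) (by norm_num) (by norm_num) hτ
  simp only [Complex.ofReal_one] at h
  exact h.congr_of_eventuallyEq
    ((eventually_re_neg hτ).mono fun z hz ↦ (tsum_rrDenTerm hz).symm)

/-- The infinite `q`-Pochhammer symbol over the real numbers. -/
noncomputable def qPochReal (a q : ℝ) : ℝ := ∏' n : ℕ, (1 - a * q ^ n)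

theorem multipliable_qPochReal (a : ℝ) {q : ℝ} (hq : 0 < q) (hq1 : q < 1) :
    Multipliable fun n : ℕ ↦ (1 - a * q ^ n) := by
  have hs : Summable fun n : ℕ ↦ ‖-(a * q ^ n)‖ := by
    simp only [norm_neg, norm_mul, norm_pow]
    exact (summable_geometric_of_lt_one (norm_nonneg _)
      (by rwa [Real.norm_of_nonneg hq.le])).mul_left _
  simpa only [sub_eq_add_neg] using multipliable_one_add_of_summable hs

theorem tendsto_qPochReal (a : ℝ) {q : ℝ} (hq : 0 < q) (hq1 : q < 1) :
    Tendsto (fun n ↦ ∏ k ∈ Finset.range n, (1 - a * q ^ k)) atTop (𝓝 (qPochReal a q)) :=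
  (multipliable_qPochReal a hq hq1).hasProd.tendsto_prod_nat

theorem norm_ofReal_lt_one {q : ℝ} (hq : 0 < q) (hq1 : q < 1) : ‖(q : ℂ)‖ < 1 := by
  rwa [Complex.norm_real, Real.norm_of_nonneg hq.le]

theorem ofReal_qPochReal (a : ℝ) {q : ℝ} (hq : 0 < q) (hq1 : q < 1) :
    ((qPochReal a q : ℝ) : ℂ) = qPoch a q := by
  refine tendsto_nhds_unique
    ((Complex.continuous_ofReal.tendsto _).comp (tendsto_qPochReal a hq hq1))
    ((tendsto_qPoch (a : ℂ) (norm_ofReal_lt_one hq hq1)).congr fun n ↦ ?_)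
  simp

theorem mul_pow_mem_Ioo {a q : ℝ} (ha : 0 < a) (ha1 : a < 1) (hq : 0 < q) (hq1 : q < 1) (n : ℕ) :
    0 < a * q ^ n ∧ a * q ^ n < 1 :=
  ⟨by positivity, mul_lt_one_of_nonneg_of_lt_one_left ha.le ha1 (pow_le_one₀ hq.le hq1.le)⟩

theorem qPochReal_pos {a q : ℝ} (ha : 0 < a) (ha1 : a < 1) (hq : 0 < q) (hq1 : q < 1) :
    0 < qPochReal a q := by
  refine lt_of_le_of_ne (ge_of_tendsto' (tendsto_qPochReal a hq hq1) fun n ↦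
    Finset.prod_nonneg fun k _ ↦ ?_) fun h ↦ ?_
  · linarith [(mul_pow_mem_Ioo ha ha1 hq hq1 k).2]
  · have h1 := ofReal_qPochReal a hq hq1
    rw [← h, Complex.ofReal_zero] at h1
    refine qPoch_ne_zero (norm_ofReal_lt_one hq hq1) (fun n h2 ↦ ?_) h1.symm
    exact (mul_pow_mem_Ioo ha ha1 hq hq1 n).2.ne (by exact_mod_cast h2)

theorem qPochReal_le_one {a q : ℝ} (ha : 0 < a) (ha1 : a < 1) (hq : 0 < q) (hq1 : q < 1) :
    qPochReal a q ≤ 1 := by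
  refine le_of_tendsto' (tendsto_qPochReal a hq hq1) fun n ↦ Finset.prod_le_one ?_ ?_ <;>
  · intro k _
    have := mul_pow_mem_Ioo ha ha1 hq hq1 k
    linarith

theorem eulerF_eq (q : ℝ) : eulerF q = qPochReal q q := by
  simp only [eulerF, qPochReal, pow_succ']

theorem eulerF_pos {q : ℝ} (hq : 0 < q) (hq1 : q < 1) : 0 < eulerF q := by
  rw [eulerF_eq]; exact qPochReal_pos hq hq1 hq hq1

theorem eulerF_le_one {q : ℝ} (hq : 0 < q) (hq1 : q < 1) : eulerF q ≤ 1 := by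
  rw [eulerF_eq]; exact qPochReal_le_one hq hq1 hq hq1

theorem eulerF_anti {p q : ℝ} (hp : 0 < p) (hpq : p ≤ q) (hq1 : q < 1) :
    eulerF q ≤ eulerF p := by
  rw [eulerF_eq, eulerF_eq]
  have hq := hp.trans_le hpq
  refine le_of_tendsto_of_tendsto' (tendsto_qPochReal q hq hq1)
    (tendsto_qPochReal p hp (hpq.trans_lt hq1)) fun n ↦ Finset.prod_le_prod (fun k _ ↦ ?_)
    fun k _ ↦ ?_
  · linarith [(mul_pow_mem_Ioo hq hq1 hq hq1 k).2]
  · gcongr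

/-- The real version of `rrNum`. -/
noncomputable def rrNumReal (q : ℝ) : ℝ :=
  qPochReal (q ^ 5) (q ^ 5) * (qPochReal q (q ^ 5) * qPochReal (q ^ 4) (q ^ 5))

/-- The real version of `rrDen`. -/
noncomputable def rrDenReal (q : ℝ) : ℝ :=
  qPochReal (q ^ 5) (q ^ 5) * (qPochReal (q ^ 2) (q ^ 5) * qPochReal (q ^ 3) (q ^ 5))

section

variable {q : ℝ}

theorem pow_mem_Ioo_of_ne_zero (hq : 0 < q) (hq1 : q < 1) {n : ℕ} (hn : n ≠ 0) :
    0 < q ^ n ∧ q ^ n < 1 :=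
  ⟨by positivity, pow_lt_one₀ hq.le hq1 hn⟩

theorem rrNumReal_pos (hq : 0 < q) (hq1 : q < 1) : 0 < rrNumReal q := by
  have h {n : ℕ} (hn : n ≠ 0) : 0 < qPochReal (q ^ n) (q ^ 5) := by
    have h1 := pow_mem_Ioo_of_ne_zero hq hq1 hn
    have h2 := pow_mem_Ioo_of_ne_zero hq hq1 (n := 5) (by norm_num)
    exact qPochReal_pos h1.1 h1.2 h2.1 h2.2
  have h1 := h one_ne_zero
  rw [pow_one] at h1
  exact mul_pos (h (by norm_num)) (mul_pos h1 (h (by norm_num)))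

theorem rrDenReal_pos (hq : 0 < q) (hq1 : q < 1) : 0 < rrDenReal q := by
  have h {n : ℕ} (hn : n ≠ 0) : 0 < qPochReal (q ^ n) (q ^ 5) := by
    have h1 := pow_mem_Ioo_of_ne_zero hq hq1 hn
    have h2 := pow_mem_Ioo_of_ne_zero hq hq1 (n := 5) (by norm_num)
    exact qPochReal_pos h1.1 h1.2 h2.1 h2.2
  exact mul_pos (h (by norm_num)) (mul_pos (h (by norm_num)) (h (by norm_num)))

theorem ofReal_rrNumReal (hq : 0 < q) (hq1 : q < 1) : ((rrNumReal q : ℝ) : ℂ) = rrNum q := by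
  have h := pow_mem_Ioo_of_ne_zero hq hq1 (n := 5) (by norm_num)
  simp only [rrNumReal, rrNum, Complex.ofReal_mul, ofReal_qPochReal _ h.1 h.2, Complex.ofReal_pow]

theorem ofReal_rrDenReal (hq : 0 < q) (hq1 : q < 1) : ((rrDenReal q : ℝ) : ℂ) = rrDen q := by
  have h := pow_mem_Ioo_of_ne_zero hq hq1 (n := 5) (by norm_num)
  simp only [rrDenReal, rrDen, Complex.ofReal_mul, ofReal_qPochReal _ h.1 h.2, Complex.ofReal_pow]

theorem ofReal_eulerF (hq : 0 < q) (hq1 : q < 1) : ((eulerF q : ℝ) : ℂ) = qPoch q q := by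
  rw [eulerF_eq, ofReal_qPochReal _ hq hq1]

theorem ofReal_eulerF_pow (hq : 0 < q) (hq1 : q < 1) :
    ((eulerF (q ^ 5) : ℝ) : ℂ) = qPoch ((q : ℂ) ^ 5) ((q : ℂ) ^ 5) := by
  have h := pow_mem_Ioo_of_ne_zero hq hq1 (n := 5) (by norm_num)
  rw [ofReal_eulerF h.1 h.2, Complex.ofReal_pow]

theorem rrNumReal_mul_rrDenReal (hq : 0 < q) (hq1 : q < 1) :
    rrNumReal q * rrDenReal q = eulerF q * eulerF (q ^ 5) := by
  have h := rrNum_mul_rrDen (norm_ofReal_lt_one hq hq1)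
  rw [← ofReal_rrNumReal hq hq1, ← ofReal_rrDenReal hq hq1, ← ofReal_eulerF hq hq1,
    ← ofReal_eulerF_pow hq hq1] at h
  exact_mod_cast h

/-- The fifth power of the Rogers–Ramanujan continued fraction. -/
noncomputable def rrFifth (q : ℝ) : ℝ := q * (rrNumReal q / rrDenReal q) ^ 5

theorem rrFifth_pos (hq : 0 < q) (hq1 : q < 1) : 0 < rrFifth q := by
  have := rrNumReal_pos hq hq1
  have := rrDenReal_pos hq hq1
  unfold rrFifth
  positivity

theorem uF_pos (hq : 0 < q) (hq1 : q < 1) : 0 < uF q := by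
  have h := pow_mem_Ioo_of_ne_zero hq hq1 (n := 5) (by norm_num)
  have := eulerF_pos hq hq1
  have := eulerF_pos h.1 h.2
  unfold uF
  positivity

theorem uF_mul_rrFifth (hq : 0 < q) (hq1 : q < 1) :
    uF q * rrFifth q = 1 - 11 * rrFifth q - rrFifth q ^ 2 := by
  have hc := qPoch_pow_eleven (norm_ofReal_lt_one hq hq1) (by exact_mod_cast hq.ne')
  rw [← ofReal_rrNumReal hq hq1, ← ofReal_rrDenReal hq hq1, ← ofReal_eulerF hq hq1,
    ← ofReal_eulerF_pow hq hq1] at hc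
  have h : eulerF q ^ 11 = eulerF (q ^ 5) * (rrDenReal q ^ 10 -
      11 * q * (rrNumReal q * rrDenReal q) ^ 5 - q ^ 2 * rrNumReal q ^ 10) := by
    exact_mod_cast hc
  have hm := rrNumReal_mul_rrDenReal hq hq1
  have h5 := pow_mem_Ioo_of_ne_zero hq hq1 (n := 5) (by norm_num)
  have hf := (eulerF_pos hq hq1).ne'
  have hg := (eulerF_pos h5.1 h5.2).ne'
  have hA := (rrNumReal_pos hq hq1).ne'
  have hB := (rrDenReal_pos hq hq1).ne'
  have h1 : 1 - 11 * rrFifth q - rrFifth q ^ 2 =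
      eulerF q ^ 11 / (eulerF (q ^ 5) * rrDenReal q ^ 10) := by
    rw [h, rrFifth]; field_simp
  have h2 : uF q * rrFifth q = eulerF q ^ 6 * (rrNumReal q * rrDenReal q) ^ 5 /
      (eulerF (q ^ 5) ^ 6 * rrDenReal q ^ 10) := by
    rw [uF, rrFifth]; field_simp
  rw [h1, h2, hm]
  field_simp

end

theorem exists_hasDerivAt_rr {s : ℝ} (hs : s < 0) :
    ∃ a b : ℝ, HasDerivAt (fun s ↦ rrNumReal (Real.exp s)) a s ∧
      HasDerivAt (fun s ↦ rrDenReal (Real.exp s)) b s ∧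
      rrNumReal (Real.exp s) * rrDenReal (Real.exp s) + 5 * (a * rrDenReal (Real.exp s)) -
        5 * (rrNumReal (Real.exp s) * b) = eulerF (Real.exp s) ^ 6 := by
  have hτ : (s : ℂ).re < 0 := hs
  have hev : ∀ᶠ t in 𝓝 s, t < 0 := gt_mem_nhds hs
  have hN {t : ℝ} (ht : t < 0) :
      rrNum (Complex.exp t) = ((rrNumReal (Real.exp t) : ℝ) : ℂ) := by
    rw [ofReal_rrNumReal (Real.exp_pos t) (Real.exp_lt_one_iff.2 ht), Complex.ofReal_exp]
  have hD {t : ℝ} (ht : t < 0) :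
      rrDen (Complex.exp t) = ((rrDenReal (Real.exp t) : ℝ) : ℂ) := by
    rw [ofReal_rrDenReal (Real.exp_pos t) (Real.exp_lt_one_iff.2 ht), Complex.ofReal_exp]
  have hw := rrNum_wronskian_rrDen hτ
  have hF := ofReal_eulerF (Real.exp_pos s) (Real.exp_lt_one_iff.2 hs)
  rw [Complex.ofReal_exp] at hF
  rw [tsum_rrNumTerm hτ, tsum_rrDenTerm hτ, hN hs, hD hs, ← hF] at hw
  refine ⟨_, _, (hasDerivAt_rrNum hτ).real_of_complex.congr_of_eventuallyEq
    (hev.mono fun t ht ↦ ?_), (hasDerivAt_rrDen hτ).real_of_complex.congr_of_eventuallyEq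
    (hev.mono fun t ht ↦ ?_), ?_⟩
  · beta_reduce; rw [hN ht, Complex.ofReal_re]
  · beta_reduce; rw [hD ht, Complex.ofReal_re]
  · have h := congrArg Complex.re hw
    rw [← Complex.ofReal_pow, ← Complex.ofReal_mul] at h
    simp only [Complex.add_re, Complex.sub_re, Complex.ofReal_re, Complex.re_mul_ofReal,
      Complex.re_ofReal_mul, show (5 : ℂ) = ((5 : ℝ) : ℂ) by norm_num] at h
    exact h

theorem hasDerivAt_rrFifth_exp {s : ℝ} (hs : s < 0) :
    HasDerivAt (fun s ↦ rrFifth (Real.exp s)) (rrFifth (Real.exp s) *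
      (eulerF (Real.exp s) ^ 5 / eulerF (Real.exp s ^ 5))) s := by
  obtain ⟨a, b, ha, hb, hw⟩ := exists_hasDerivAt_rr hs
  have hx := Real.exp_pos s
  have hx1 := Real.exp_lt_one_iff.2 hs
  have h5 := pow_mem_Ioo_of_ne_zero hx hx1 (n := 5) (by norm_num)
  have hm := rrNumReal_mul_rrDenReal hx hx1
  have hA := (rrNumReal_pos hx hx1).ne'
  have hB := (rrDenReal_pos hx hx1).ne'
  have hf := (eulerF_pos hx hx1).ne'
  have hg := (eulerF_pos h5.1 h5.2).ne'
  have h := (Real.hasDerivAt_exp s).mul ((ha.div hb hB).pow 5)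
  refine h.congr_deriv ?_
  have h1 : eulerF (Real.exp s) ^ 5 / eulerF (Real.exp s ^ 5) =
      eulerF (Real.exp s) ^ 6 / (rrNumReal (Real.exp s) * rrDenReal (Real.exp s)) := by
    rw [hm]; field_simp
  rw [h1, ← hw, rrFifth]
  simp only [Pi.div_apply, Pi.pow_apply, Nat.add_one_sub_one, Nat.cast_ofNat]
  field_simp
  ring

theorem hasDerivAt_rrFifth_rpow {t : ℝ} (ht : 0 < t) (ht1 : t < 1) :
    HasDerivAt (fun t ↦ rrFifth (t ^ ((1 : ℝ) / 5))) (rrFifth (t ^ ((1 : ℝ) / 5)) *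
      (eulerF (t ^ ((1 : ℝ) / 5)) ^ 5 / eulerF t) / (5 * t)) t := by
  have he {x : ℝ} (hx : 0 < x) : x ^ ((1 : ℝ) / 5) = Real.exp (Real.log x / 5) := by
    rw [Real.rpow_def_of_pos hx]; congr 1; ring
  have hs : Real.log t / 5 < 0 := by
    have := Real.log_neg ht ht1; linarith
  have h := (hasDerivAt_rrFifth_exp hs).comp t ((Real.hasDerivAt_log ht.ne').div_const 5)
  have h5 : Real.exp (Real.log t / 5) ^ 5 = t := by
    rw [← Real.exp_nat_mul]
    conv_rhs => rw [← Real.exp_log ht]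
    congr 1; push_cast; ring
  rw [h5, ← he ht] at h
  refine (h.congr_of_eventuallyEq ?_).congr_deriv ?_
  · filter_upwards [lt_mem_nhds ht] with x hx
    rw [Function.comp_apply, he hx]
  · field_simp

theorem rpow_fifth_pos_lt_one {t : ℝ} (ht : 0 < t) (ht1 : t < 1) :
    0 < t ^ ((1 : ℝ) / 5) ∧ t ^ ((1 : ℝ) / 5) < 1 :=
  ⟨Real.rpow_pos_of_pos ht _, Real.rpow_lt_one ht.le ht1 (by norm_num)⟩

theorem rpow_fifth_pow {t : ℝ} (ht : 0 ≤ t) : (t ^ ((1 : ℝ) / 5)) ^ 5 = t := by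
  rw [← Real.rpow_natCast, ← Real.rpow_mul ht]; norm_num

theorem rrFifth_zero : rrFifth 0 = 0 := by simp [rrFifth]

theorem rrFifth_le {x : ℝ} (hx : 0 < x) (hx2 : x ≤ 1 / 2) :
    rrFifth x ≤ x / eulerF (1 / 2) ^ 6 := by
  have hx1 : x < 1 := by linarith
  have h5 := pow_mem_Ioo_of_ne_zero hx hx1 (n := 5) (by norm_num)
  have hu := uF_mul_rrFifth hx hx1
  have hr := rrFifth_pos hx hx1
  have hc := eulerF_pos (q := 1 / 2) (by norm_num) (by norm_num)
  have hf := eulerF_anti hx hx2 (by norm_num)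
  have hg0 := eulerF_pos h5.1 h5.2
  have hg := eulerF_le_one h5.1 h5.2
  have h1 : eulerF (1 / 2) ^ 6 / x ≤ uF x := by
    rw [uF]
    have := pow_le_one₀ (n := 6) hg0.le hg
    have : x * eulerF (x ^ 5) ^ 6 ≤ x := mul_le_of_le_one_right hx.le this
    gcongr
  have h2 : eulerF (1 / 2) ^ 6 / x * rrFifth x ≤ 1 := by
    refine (mul_le_mul_of_nonneg_right h1 hr.le).trans ?_
    nlinarith
  rw [le_div_iff₀ (by positivity)]
  rw [div_mul_eq_mul_div, div_le_one hx] at h2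
  linarith

theorem continuousWithinAt_rrFifth_zero : ContinuousWithinAt rrFifth (Set.Ici 0) 0 := by
  rw [ContinuousWithinAt, rrFifth_zero]
  have h : Tendsto (fun x : ℝ ↦ x / eulerF (1 / 2) ^ 6) (𝓝[≥] 0) (𝓝 0) := by
    have : Tendsto (fun x : ℝ ↦ x / eulerF (1 / 2) ^ 6) (𝓝 0) (𝓝 (0 / eulerF (1 / 2) ^ 6)) :=
      tendsto_id.div_const _
    rw [zero_div] at this
    exact this.mono_left nhdsWithin_le_nhds
  have hev : ∀ᶠ x in 𝓝[≥] (0 : ℝ), 0 ≤ rrFifth x ∧ rrFifth x ≤ x / eulerF (1 / 2) ^ 6 := by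
    filter_upwards [self_mem_nhdsWithin,
      nhdsWithin_le_nhds (gt_mem_nhds (show (0 : ℝ) < 1 / 2 by norm_num))] with x hx hx2
    rcases eq_or_lt_of_le (Set.mem_Ici.1 hx) with rfl | h0
    · simp [rrFifth_zero]
    · exact ⟨(rrFifth_pos h0 (by linarith)).le, rrFifth_le h0 hx2.le⟩
  exact squeeze_zero' (hev.mono fun _ h ↦ h.1) (hev.mono fun _ h ↦ h.2) h

theorem continuousOn_rrFifth_rpow {q : ℝ} (hq1 : q < 1) :
    ContinuousOn (fun t ↦ rrFifth (t ^ ((1 : ℝ) / 5))) (Set.Icc 0 q) := by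
  intro t ht
  rcases eq_or_lt_of_le ht.1 with rfl | h0
  · have h1 : ContinuousWithinAt (fun t : ℝ ↦ t ^ ((1 : ℝ) / 5)) (Set.Icc 0 q) 0 :=
      (Real.continuousAt_rpow_const _ _ (.inr (by norm_num))).continuousWithinAt
    have h2 : (0 : ℝ) ^ ((1 : ℝ) / 5) = 0 := Real.zero_rpow (by norm_num)
    have h3 : ContinuousWithinAt rrFifth (Set.Ici 0) ((0 : ℝ) ^ ((1 : ℝ) / 5)) := by
      rw [h2]; exact continuousWithinAt_rrFifth_zero
    exact ContinuousWithinAt.comp (g := rrFifth) (f := fun t : ℝ ↦ t ^ ((1 : ℝ) / 5)) h3 h1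
      fun x hx ↦ Set.mem_Ici.2 (Real.rpow_nonneg hx.1 _)
  · exact (hasDerivAt_rrFifth_rpow h0 (ht.2.trans_lt hq1)).continuousAt.continuousWithinAt

/-- The bound `(5√5 - 11)/2` is the positive root of `1 - 11 r - r²`. -/
theorem rrFifth_lt {x : ℝ} (hx : 0 < x) (hx1 : x < 1) : rrFifth x < (5 * √5 - 11) / 2 := by
  have hu := uF_mul_rrFifth hx hx1
  have hr := rrFifth_pos hx hx1
  have hw := mul_pos (uF_pos hx hx1) hr
  have hs : √5 ^ 2 = 5 := Real.sq_sqrt (by norm_num)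
  have hs0 := Real.sqrt_nonneg 5
  nlinarith

theorem log_primitive_deriv {s r w r' : ℝ} (hs : s ^ 2 = 5) (hu : w * r = 1 - 11 * r - r ^ 2)
    (h1 : r + (11 + 5 * s) / 2 ≠ 0) (h2 : (5 * s - 11) / 2 - r ≠ 0) (hr : r ≠ 0) (hw : w ≠ 0) :
    r' / (r + (11 + 5 * s) / 2) - -r' / ((5 * s - 11) / 2 - r) = s * (5 * r' / (r * w)) := by
  have h3 : (r + (11 + 5 * s) / 2) * ((5 * s - 11) / 2 - r) = w * r := by
    linear_combination 25 / 4 * hs - hu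
  rw [div_sub_div _ _ h1 h2, h3]
  field_simp
  ring

theorem moebius_eq_sqrt_formula {s r w : ℝ} (hs0 : 0 < s) (hs : s ^ 2 = 5) (hr : 0 < r) (hw : 0 < w)
    (hu : w * r = 1 - 11 * r - r ^ 2) (h2 : r < (5 * s - 11) / 2) :
    (r + (11 + 5 * s) / 2) / ((11 + 5 * s) / 2) * (((5 * s - 11) / 2) / ((5 * s - 11) / 2 - r)) =
      (125 + 11 * w + 5 * s * √(125 + 22 * w + w ^ 2)) / ((11 + 5 * s) * w) := by
  have hsq : √(125 + 22 * w + w ^ 2) = (1 + r ^ 2) / r := by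
    have h : 125 + 22 * w + w ^ 2 = ((1 + r ^ 2) / r) ^ 2 := by
      field_simp
      linear_combination (w * r + 11 * r + 1 - r ^ 2) * hu
    rw [h, Real.sqrt_sq (by positivity)]
  have h3 : (5 * s - 11) / 2 - r ≠ 0 := by linarith
  have hX : 125 + 11 * w + 5 * s * ((1 + r ^ 2) / r) =
      (5 * s - 11) * (r + (11 + 5 * s) / 2) ^ 2 / r := by
    field_simp
    linear_combination 4 * 11 * hu - (100 * r + 25 * (11 + 5 * s)) * hs
  rw [hsq, hX, div_mul_div_comm, div_eq_div_iff (by positivity) (by positivity)]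
  field_simp
  linear_combination (5 * s - 11) * (4 * hu - 25 * hs)

theorem exp_integral_w (q : ℝ) (hq : 0 < q) (hq1 : q < 1) :
    Real.exp (Real.sqrt 5 *
        ∫ t in (0:ℝ)..q,
          eulerF t ^ 5 / (eulerF (t ^ ((1 : ℝ) / 5)) * t ^ ((4 : ℝ) / 5))) =
      (125 + 11 * uF (q ^ ((1 : ℝ) / 5)) + 5 * Real.sqrt 5 *
          Real.sqrt (125 + 22 * uF (q ^ ((1 : ℝ) / 5)) + uF (q ^ ((1 : ℝ) / 5)) ^ 2)) /
        ((11 + 5 * Real.sqrt 5) * uF (q ^ ((1 : ℝ) / 5))) ∧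
    uF (q ^ ((1 : ℝ) / 5)) =
      eulerF (q ^ ((1 : ℝ) / 5)) ^ 6 / (q ^ ((1 : ℝ) / 5) * eulerF q ^ 6) := by
  have hs : √5 ^ 2 = 5 := Real.sq_sqrt (by norm_num)
  have hs0 : 0 < √5 := Real.sqrt_pos.2 (by norm_num)
  have hs2 : 11 < 5 * √5 := by nlinarith
  set R : ℝ → ℝ := fun t ↦ rrFifth (t ^ ((1 : ℝ) / 5)) with hR
  have hR0 : R 0 = 0 := by
    simp only [hR]
    rw [Real.zero_rpow (by norm_num), rrFifth_zero]
  have hRpos {t : ℝ} (ht : 0 < t) (ht1 : t < 1) : 0 < R t :=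
    rrFifth_pos (rpow_fifth_pos_lt_one ht ht1).1 (rpow_fifth_pos_lt_one ht ht1).2
  have hRlt {t : ℝ} (ht : 0 < t) (ht1 : t < 1) : R t < (5 * √5 - 11) / 2 :=
    rrFifth_lt (rpow_fifth_pos_lt_one ht ht1).1 (rpow_fifth_pos_lt_one ht ht1).2
  have hbounds {t : ℝ} (ht : t ∈ Set.Icc 0 q) :
      0 < R t + (11 + 5 * √5) / 2 ∧ 0 < (5 * √5 - 11) / 2 - R t := by
    rcases eq_or_lt_of_le ht.1 with rfl | h0
    · rw [hR0]; constructor <;> linarith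
    · have h1 := hRpos h0 (ht.2.trans_lt hq1)
      have h2 := hRlt h0 (ht.2.trans_lt hq1)
      constructor <;> linarith
  have hRc := continuousOn_rrFifth_rpow hq1
  set F : ℝ → ℝ := fun t ↦
    Real.log (R t + (11 + 5 * √5) / 2) - Real.log ((5 * √5 - 11) / 2 - R t) with hF
  have hFc : ContinuousOn F (Set.Icc 0 q) :=
    ((hRc.add continuousOn_const).log fun t ht ↦ (hbounds ht).1.ne').sub
      ((continuousOn_const.sub hRc).log fun t ht ↦ (hbounds ht).2.ne')
  have hFd : ∀ t ∈ Set.Ioo 0 q, HasDerivAt F (√5 *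
      (eulerF t ^ 5 / (eulerF (t ^ ((1 : ℝ) / 5)) * t ^ ((4 : ℝ) / 5)))) t := by
    intro t ht
    have ht1 := ht.2.trans hq1
    have hb := hbounds ⟨ht.1.le, ht.2.le⟩
    have hx := rpow_fifth_pos_lt_one ht.1 ht1
    have hd := hasDerivAt_rrFifth_rpow ht.1 ht1
    have hu := uF_mul_rrFifth hx.1 hx.2
    have hup := uF_pos hx.1 hx.2
    refine (((hd.add_const _).log hb.1.ne').sub ((hd.const_sub _).log hb.2.ne')).congr_deriv ?_
    refine (log_primitive_deriv hs hu hb.1.ne' hb.2.ne' (hRpos ht.1 ht1).ne' hup.ne').trans ?_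
    congr 1
    have hp := rpow_fifth_pow ht.1.le
    have h45 : t ^ ((4 : ℝ) / 5) = (t ^ ((1 : ℝ) / 5)) ^ 4 := by
      rw [← Real.rpow_natCast, ← Real.rpow_mul ht.1.le]; norm_num
    have hr := (hRpos ht.1 ht1).ne'
    have hf := (eulerF_pos hx.1 hx.2).ne'
    have hg := (eulerF_pos ht.1 ht1).ne'
    have hx0 := hx.1.ne'
    rw [h45, uF, hp]
    simp only [hR] at hr
    field_simp
    rw [hp]
    exact div_self ht.1.ne'
  have hnn : ∀ t ∈ Set.Ioo 0 q, 0 ≤ √5 *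
      (eulerF t ^ 5 / (eulerF (t ^ ((1 : ℝ) / 5)) * t ^ ((4 : ℝ) / 5))) := by
    intro t ht
    have ht1 := ht.2.trans hq1
    have hx := rpow_fifth_pos_lt_one ht.1 ht1
    have := eulerF_pos hx.1 hx.2
    have := eulerF_pos ht.1 ht1
    have := ht.1
    positivity
  have hint := intervalIntegral.integral_eq_sub_of_hasDerivAt_of_le hq.le hFc hFd
    ((intervalIntegrable_iff_integrableOn_Ioc_of_le hq.le).2
      (intervalIntegral.integrableOn_deriv_of_nonneg hFc hFd hnn))
  have hx := rpow_fifth_pos_lt_one hq hq1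
  refine ⟨?_, by rw [uF, rpow_fifth_pow hq.le]⟩
  rw [← intervalIntegral.integral_const_mul, hint,
    ← moebius_eq_sqrt_formula hs0 hs (hRpos hq hq1) (uF_pos hx.1 hx.2) (uF_mul_rrFifth hx.1 hx.2)
      (hRlt hq hq1)]
  have hbq := hbounds ⟨hq.le, le_rfl⟩
  simp only [hF, hR0]
  rw [Real.exp_sub, Real.exp_sub, Real.exp_sub, Real.exp_log hbq.1, Real.exp_log hbq.2,
    Real.exp_log (by linarith), Real.exp_log (by linarith)]
  have := hbq.2.ne'
  have h3 : 5 * √5 - 11 ≠ 0 := by linarith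
  rw [zero_add, sub_zero]
  field_simp
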